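/- arXiv:0911.3173 — 2 statements merged into one kernel-verified Lean document; each statement's English description precedes it below -/
import Mathlib

section
/- Let G be a finitely presented group and let 𝒜 be any collection of subgroups of G closed under conjugation and under passing to subgroups. Then a JSJ tree of G over 𝒜 exists: there is a universally elliptic 𝒜-tree T that dominates every universally elliptic 𝒜-tree. Moreover, T can be chosen so that all of its edge stabilizers and vertex stabilizers are finitely generated. -/
universe u v

/-- A `G`-tree: a nonempty simple graph which is a tree (connected and acyclic),
with a minimal action of `G` by graph automorphisms without inversions. -/
structure GTree (G : Type u) [Group G] : Type (u + 1) where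
  V : Type u
  graph : SimpleGraph V
  nonempty : Nonempty V
  connected : graph.Connected
  acyclic : graph.IsAcyclic
  act : G → V → V
  act_one : ∀ w, act 1 w = w
  act_mul : ∀ g h w, act (g * h) w = act g (act h w)
  act_adj : ∀ g a b, graph.Adj a b → graph.Adj (act g a) (act g b)
  noInversion : ∀ g a b, graph.Adj a b → ¬(act g a = b ∧ act g b = a)
  minimal : ∀ S : Set V, S.Nonempty → (∀ g, ∀ w ∈ S, act g w ∈ S) →
    (graph.induce S).Connected → S = Set.univ

namespace GTree

variable {G : Type u} [Group G]

/-- The stabilizer of a vertex. -/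
def vertexStab (T : GTree G) (w : T.V) : Subgroup G where
  carrier := {g | T.act g w = w}
  one_mem' := T.act_one w
  mul_mem' := by
    intro a b ha hb
    simp only [Set.mem_setOf_eq] at *
    rw [T.act_mul, hb, ha]
  inv_mem' := by
    intro a ha
    simp only [Set.mem_setOf_eq] at *
    calc T.act a⁻¹ w = T.act a⁻¹ (T.act a w) := by rw [ha]
    _ = T.act (a⁻¹ * a) w := (T.act_mul _ _ _).symm
    _ = w := by rw [inv_mul_cancel, T.act_one]

/-- The stabilizer of an edge `{u,v}`: elements fixing both endpoints. -/
def edgeStab (T : GTree G) (a b : T.V) : Subgroup G :=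
  T.vertexStab a ⊓ T.vertexStab b

/-- A subgroup is elliptic in `T` if it fixes a vertex. -/
def EllipticSubgroup (T : GTree G) (H : Subgroup G) : Prop :=
  ∃ w : T.V, ∀ h ∈ H, T.act h w = w

/-- An element is elliptic in `T` if it fixes a vertex (otherwise it is hyperbolic). -/
def EllipticElt (T : GTree G) (g : G) : Prop :=
  ∃ w : T.V, T.act g w = w

/-- `T₁` dominates `T₂`: every subgroup elliptic in `T₁` is elliptic in `T₂`. -/
def Dominates (T₁ T₂ : GTree G) : Prop :=
  ∀ H : Subgroup G, T₁.EllipticSubgroup H → T₂.EllipticSubgroup H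

/-- `T` is an `𝒜`-tree: all its edge stabilizers belong to `𝒜`. -/
def IsATree (T : GTree G) (𝒜 : Set (Subgroup G)) : Prop :=
  ∀ a b : T.V, T.graph.Adj a b → T.edgeStab a b ∈ 𝒜

/-- A subgroup is universally elliptic if it is elliptic in every `𝒜`-tree. -/
def UnivEllipticSubgroup (𝒜 : Set (Subgroup G)) (H : Subgroup G) : Prop :=
  ∀ T : GTree G, T.IsATree 𝒜 → T.EllipticSubgroup H

/-- An `𝒜`-tree is universally elliptic if all its edge stabilizers are universally elliptic. -/
def UnivEllipticTree (T : GTree G) (𝒜 : Set (Subgroup G)) : Prop :=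
  ∀ a b : T.V, T.graph.Adj a b → UnivEllipticSubgroup 𝒜 (T.edgeStab a b)

/-- A JSJ tree of `G` over `𝒜`: a universally elliptic `𝒜`-tree dominating every
universally elliptic `𝒜`-tree. -/
def IsJSJ (T : GTree G) (𝒜 : Set (Subgroup G)) : Prop :=
  T.IsATree 𝒜 ∧ T.UnivEllipticTree 𝒜 ∧
    ∀ T' : GTree G, T'.IsATree 𝒜 → T'.UnivEllipticTree 𝒜 → T.Dominates T'

/-- A collapse map `T → T'`: a `G`-equivariant surjection on vertices sending adjacent
vertices to adjacent or equal vertices, with connected point preimages. -/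
def IsCollapseMap (T T' : GTree G) (f : T.V → T'.V) : Prop :=
  (∀ g w, f (T.act g w) = T'.act g (f w)) ∧
    Function.Surjective f ∧
    (∀ a b : T.V, T.graph.Adj a b → f a = f b ∨ T'.graph.Adj (f a) (f b)) ∧
    ∀ w : T'.V, (T.graph.induce (f ⁻¹' {w})).Connected

end GTree

/-- `𝒜` is closed under conjugation and under passing to subgroups. -/
def ClosedFamily {G : Type u} [Group G] (𝒜 : Set (Subgroup G)) : Prop :=
  (∀ H ∈ 𝒜, ∀ g : G, Subgroup.map (MulAut.conj g).toMonoidHom H ∈ 𝒜) ∧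
    ∀ H ∈ 𝒜, ∀ K : Subgroup G, K ≤ H → K ∈ 𝒜

/-- `G` is finitely presented: it admits a presentation with finitely many generators
and finitely many relations. -/
def FinitelyPresentedGroup (G : Type u) [Group G] : Prop :=
  ∃ (n : ℕ) (rels : Set (FreeGroup (Fin n))),
    rels.Finite ∧ Nonempty (PresentedGroup rels ≃* G)

/-- `T` is an `(𝒜,ℋ)`-tree: an `𝒜`-tree in which every subgroup in `ℋ` is elliptic. -/
def RelATree {G : Type u} [Group G] (𝒜 ℋ : Set (Subgroup G)) (T : GTree G) : Prop :=
  T.IsATree 𝒜 ∧ ∀ H ∈ ℋ, T.EllipticSubgroup H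

/-- A subgroup is universally elliptic relative to `ℋ` if it is elliptic in every
`(𝒜,ℋ)`-tree. -/
def RelUnivEllipticSubgroup {G : Type u} [Group G] (𝒜 ℋ : Set (Subgroup G))
    (K : Subgroup G) : Prop :=
  ∀ T : GTree G, RelATree 𝒜 ℋ T → T.EllipticSubgroup K

/-- An `(𝒜,ℋ)`-tree is universally elliptic if all its edge stabilizers are universally
elliptic relative to `ℋ`. -/
def RelUnivEllipticTree {G : Type u} [Group G] (𝒜 ℋ : Set (Subgroup G))
    (T : GTree G) : Prop :=
  ∀ a b : T.V, T.graph.Adj a b → RelUnivEllipticSubgroup 𝒜 ℋ (T.edgeStab a b)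

/-- A JSJ tree of `G` over `𝒜` relative to `ℋ`. -/
def IsRelJSJ {G : Type u} [Group G] (𝒜 ℋ : Set (Subgroup G)) (T : GTree G) : Prop :=
  RelATree 𝒜 ℋ T ∧ RelUnivEllipticTree 𝒜 ℋ T ∧
    ∀ T' : GTree G, RelATree 𝒜 ℋ T' → RelUnivEllipticTree 𝒜 ℋ T' → T.Dominates T'

/-- The family of groups `F, H₁, …, H_p` whose free product is used to define relative
finite presentability. -/
def relFam {G : Type u} [Group G] {p : ℕ} (H : Fin p → Subgroup G) (n : ℕ) :
    Option (Fin p) → Type u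
  | none => FreeGroup (ULift.{u} (Fin n))
  | some j => H j

instance relFamGroup {G : Type u} [Group G] {p : ℕ} (H : Fin p → Subgroup G) (n : ℕ) :
    (i : Option (Fin p)) → Group (relFam H n i)
  | none => inferInstanceAs (Group (FreeGroup _))
  | some j => inferInstanceAs (Group (H j))

/-- `G` is finitely presented relative to `H₁, …, H_p`: there is a surjection from
`F ∗ H₁ ∗ ⋯ ∗ H_p` (with `F` a finitely generated free group) onto `G` restricting to
the inclusion on each `Hᵢ`, whose kernel is the normal closure of a finite subset. -/
def RelFinitelyPresented {G : Type u} [Group G] {p : ℕ} (H : Fin p → Subgroup G) : Prop :=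
  ∃ (n : ℕ) (φ : Monoid.CoprodI (relFam H n) →* G),
    Function.Surjective φ ∧
    (∀ (j : Fin p) (h : H j), φ (Monoid.CoprodI.of (M := relFam H n) (i := some j) h) = (h : G)) ∧
    ∃ s : Set (Monoid.CoprodI (relFam H n)), s.Finite ∧
      MonoidHom.ker φ = Subgroup.normalClosure s

/-- `S` has a single orbit of edges. -/
def OneEdgeOrbit {G : Type u} [Group G] (S : GTree G) : Prop :=
  ∀ e₁ ∈ S.graph.edgeSet, ∀ e₂ ∈ S.graph.edgeSet, ∃ g : G, Sym2.map (S.act g) e₁ = e₂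

/-- `G` splits over `K`: there is a nontrivial `G`-tree with a single orbit of edges
having `K` as an edge stabilizer. -/
def SplitsOver {G : Type u} [Group G] (K : Subgroup G) : Prop :=
  ∃ S : GTree G, Nontrivial S.V ∧ OneEdgeOrbit S ∧
    ∃ x y : S.V, S.graph.Adj x y ∧ S.edgeStab x y = K

/-- A subgroup is slender if all its subgroups are finitely generated. -/
def SlenderSubgroup {G : Type u} [Group G] (H : Subgroup G) : Prop :=
  ∀ K : Subgroup G, K ≤ H → K.FG

/-- A subgroup is abelian. -/
def AbelianSubgroup {G : Type u} [Group G] (H : Subgroup G) : Prop :=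
  ∀ a ∈ H, ∀ b ∈ H, a * b = b * a

/-- `H` is malnormal in `G`: `gHg⁻¹ ∩ H ≠ {1}` implies `g ∈ H`. -/
def Malnormal {G : Type u} [Group G] (H : Subgroup G) : Prop :=
  ∀ g : G, (∃ x ∈ H, x ≠ 1 ∧ g * x * g⁻¹ ∈ H) → g ∈ H

/-- `G` is CSA: the centralizer of every nontrivial element is abelian and malnormal. -/
def IsCSA (G : Type u) [Group G] : Prop :=
  ∀ g : G, g ≠ 1 →
    AbelianSubgroup (Subgroup.centralizer {g}) ∧ Malnormal (Subgroup.centralizer {g})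

namespace JSJ

section

open scoped Pointwise

/-! ### Half-trees and betweenness -/

section Tree

variable {V : Type*} {Γ : SimpleGraph V}

/-- `v` is strictly closer to `q` than to `p`. For adjacent `p, q` in a tree this says that `v`
lies on the `q`-side of the edge `pq`. -/
def Side (Γ : SimpleGraph V) (p q v : V) : Prop := Γ.dist v q < Γ.dist v p

/-- `r` lies on the geodesic from `a` to `b`. -/
def Btw (Γ : SimpleGraph V) (a r b : V) : Prop := Γ.dist a r + Γ.dist r b = Γ.dist a b

/-- The oriented edges separating `a` from `b`. -/
def Sep (Γ : SimpleGraph V) (a b : V) : Set (V × V) :=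
  {e | Γ.Adj e.1 e.2 ∧ ¬ Side Γ e.1 e.2 a ∧ Side Γ e.1 e.2 b}

theorem side_iff (hΓ : Γ.IsTree) {p q : V} (h : Γ.Adj p q) (v : V) :
    Side Γ p q v ↔ Γ.dist v p = Γ.dist v q + 1 := by
  have h1 := hΓ.dist_eq_dist_add_one_of_adj v h
  unfold Side
  omega

theorem not_side_iff (hΓ : Γ.IsTree) {p q : V} (h : Γ.Adj p q) (v : V) :
    ¬ Side Γ p q v ↔ Γ.dist v q = Γ.dist v p + 1 := by
  have h1 := hΓ.dist_eq_dist_add_one_of_adj v h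
  unfold Side
  omega

theorem side_symm (hΓ : Γ.IsTree) {p q : V} (h : Γ.Adj p q) (v : V) :
    Side Γ q p v ↔ ¬ Side Γ p q v := by
  have h1 := hΓ.dist_eq_dist_add_one_of_adj v h
  unfold Side
  omega

theorem side_right {p q : V} (h : Γ.Adj p q) : Side Γ p q q := by
  have := SimpleGraph.dist_eq_one_iff_adj.2 h.symm
  unfold Side
  rw [this]; simp

theorem not_side_left {p q : V} (_h : Γ.Adj p q) : ¬ Side Γ p q p := by
  unfold Side
  simp

theorem eq_of_side_of_not_side (hΓ : Γ.IsTree) {p q u v : V} (hpq : Γ.Adj p q) (huv : Γ.Adj u v)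
    (hv : Side Γ p q v) (hu : ¬ Side Γ p q u) : u = p ∧ v = q := by
  rw [side_iff hΓ hpq] at hv
  rw [not_side_iff hΓ hpq] at hu
  have h1 := hΓ.dist_eq_dist_add_one_of_adj p huv
  have h2 := hΓ.dist_eq_dist_add_one_of_adj q huv
  rw [Γ.dist_comm (u := p) (v := u), Γ.dist_comm (u := p) (v := v)] at h1
  rw [Γ.dist_comm (u := q) (v := u), Γ.dist_comm (u := q) (v := v)] at h2
  have hmn : Γ.dist u p = Γ.dist v q := by omega
  obtain ⟨W, hW⟩ := hΓ.1.exists_walk_length_eq_dist u p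
  obtain ⟨W₂, hW₂⟩ := hΓ.1.exists_walk_length_eq_dist v q
  have hp1 : (W.concat hpq).IsPath :=
    SimpleGraph.Walk.isPath_of_length_eq_dist _ (by simp [hW, hu])
  have hp2 : (SimpleGraph.Walk.cons huv W₂).IsPath :=
    SimpleGraph.Walk.isPath_of_length_eq_dist _ (by simp [hW₂]; omega)
  have heq : W.concat hpq = SimpleGraph.Walk.cons huv W₂ :=
    congrArg Subtype.val ((hΓ.2.subsingleton_path u q).elim ⟨_, hp1⟩ ⟨_, hp2⟩)
  cases W with
  | nil =>
    simp only [SimpleGraph.dist_self] at hmn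
    exact ⟨rfl, (hΓ.1.dist_eq_zero_iff).1 hmn.symm⟩
  | cons h' W' =>
    exfalso
    rw [SimpleGraph.Walk.concat_cons] at heq
    injection heq with _ hvv _
    subst hvv
    have := SimpleGraph.dist_le W'
    simp at hW
    omega

theorem dist_eq_of_side (hΓ : Γ.IsTree) {p q a b : V} (hpq : Γ.Adj p q)
    (ha : ¬ Side Γ p q a) (hb : Side Γ p q b) :
    Γ.dist a b = Γ.dist a p + 1 + Γ.dist q b := by
  apply le_antisymm
  · have h1 := hΓ.1.dist_triangle (u := a) (v := p) (w := b)
    have h2 := hΓ.1.dist_triangle (u := p) (v := q) (w := b)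
    rw [SimpleGraph.dist_eq_one_iff_adj.2 hpq] at h2
    omega
  · obtain ⟨W, hW⟩ := hΓ.1.exists_walk_length_eq_dist a b
    rw [← hW]
    clear hW
    induction W with
    | nil => exact absurd hb ha
    | @cons u v w h W ih =>
      by_cases hv : Side Γ p q v
      · obtain ⟨rfl, rfl⟩ := eq_of_side_of_not_side hΓ hpq h hv ha
        have := SimpleGraph.dist_le W
        simp; omega
      · have := ih hv hb
        have h3 := hΓ.1.dist_triangle (u := u) (v := v) (w := p)
        rw [SimpleGraph.dist_eq_one_iff_adj.2 h] at h3
        simp; omega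

theorem Btw.symm {a r b : V} (h : Btw Γ a r b) : Btw Γ b r a := by
  unfold Btw at *
  rw [Γ.dist_comm (u := b) (v := r), Γ.dist_comm (u := r) (v := a), Γ.dist_comm (u := b) (v := a)]
  omega

theorem btw_left (a b : V) : Btw Γ a a b := by simp [Btw]

theorem Btw.side (hΓ : Γ.IsTree) {p q a r b : V} (hpq : Γ.Adj p q) (h : Btw Γ a r b)
    (ha : Side Γ p q a) (hb : Side Γ p q b) : Side Γ p q r := by
  by_contra hr
  have h1 := dist_eq_of_side hΓ hpq hr ha
  have h2 := dist_eq_of_side hΓ hpq hr hb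
  have h3 := hΓ.1.dist_triangle (u := a) (v := q) (w := b)
  unfold Btw at h
  rw [Γ.dist_comm (u := a) (v := r)] at h
  rw [Γ.dist_comm (u := a) (v := q)] at h3
  omega

theorem Btw.not_side (hΓ : Γ.IsTree) {p q a r b : V} (hpq : Γ.Adj p q) (h : Btw Γ a r b)
    (ha : ¬ Side Γ p q a) (hb : ¬ Side Γ p q b) : ¬ Side Γ p q r := by
  rw [← side_symm hΓ hpq] at *
  exact h.side hΓ hpq.symm ha hb

theorem btw_of_sep (hΓ : Γ.IsTree) {p q a b : V} (hpq : Γ.Adj p q)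
    (ha : ¬ Side Γ p q a) (hb : Side Γ p q b) : Btw Γ a p b ∧ Btw Γ a q b := by
  have h := dist_eq_of_side hΓ hpq ha hb
  have h1 := (side_iff hΓ hpq b).1 hb
  have h2 := (not_side_iff hΓ hpq a).1 ha
  unfold Btw
  rw [Γ.dist_comm (u := p) (v := b), Γ.dist_comm (u := q) (v := b)] at *
  omega

theorem exists_next (hΓ : Γ.IsTree) {a b : V} (h : a ≠ b) : ∃ r, Γ.Adj a r ∧ Side Γ a r b := by
  obtain ⟨W, hW⟩ := hΓ.1.exists_walk_length_eq_dist a b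
  cases W with
  | nil => exact absurd rfl h
  | @cons _ r _ h' W' =>
    refine ⟨r, h', ?_⟩
    have := SimpleGraph.dist_le W'
    simp at hW
    unfold Side
    rw [Γ.dist_comm (u := b) (v := a), Γ.dist_comm (u := b) (v := r)]
    omega

theorem next_unique (hΓ : Γ.IsTree) {a b r r' : V} (hr : Γ.Adj a r) (hr' : Γ.Adj a r')
    (h : Side Γ a r b) (h' : Side Γ a r' b) : r = r' := by
  by_contra hne
  have hs : ¬ Side Γ a r r' := by
    intro hs
    exact hne (eq_of_side_of_not_side hΓ hr hr' hs (not_side_left hr)).2.symm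
  have h1 := dist_eq_of_side hΓ hr hs h
  have h2 := (side_iff hΓ hr b).1 h
  have h3 := (side_iff hΓ hr' b).1 h'
  rw [SimpleGraph.dist_eq_one_iff_adj.2 hr'.symm] at h1
  rw [Γ.dist_comm (u := b) (v := r')] at h3
  rw [Γ.dist_comm (u := b) (v := r)] at h2
  omega

theorem Btw.or (hΓ : Γ.IsTree) {a r b : V} (h : Btw Γ a r b) (c : V) :
    Btw Γ a r c ∨ Btw Γ c r b := by
  by_cases har : a = r
  · subst har; exact Or.inl (btw_left _ _)
  obtain ⟨p, hp, hs⟩ := exists_next hΓ (Ne.symm har)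
  have hb : ¬ Side Γ r p b := by
    intro hb
    exact not_side_left hp (h.side hΓ hp hs hb)
  by_cases hc : Side Γ r p c
  · right; exact (btw_of_sep hΓ hp hb hc).1.symm
  · left; exact (btw_of_sep hΓ hp hc hs).1.symm

theorem Btw.eq_of_dist_eq (hΓ : Γ.IsTree) {a q q' b : V} (h : Btw Γ a q b) (h' : Btw Γ a q' b)
    (hd : Γ.dist a q = Γ.dist a q') : q = q' := by
  rw [← hΓ.1.dist_eq_zero_iff]
  unfold Btw at *
  rcases Btw.or hΓ h q' with h1 | h1
  · unfold Btw at h1; omega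
  · unfold Btw at h1
    rw [Γ.dist_comm (u := q) (v := q')]
    omega

theorem exists_next_of_not_btw (hΓ : Γ.IsTree) {q b c : V} (h : ¬ Btw Γ b q c) :
    ∃ r, Γ.Adj q r ∧ Side Γ q r b ∧ Side Γ q r c := by
  have hne : q ≠ b := by
    rintro rfl; exact h (btw_left _ _)
  obtain ⟨r, hr, hs⟩ := exists_next hΓ hne
  refine ⟨r, hr, hs, ?_⟩
  by_contra hc
  exact h (btw_of_sep hΓ hr hc hs).1.symm

theorem median_unique (hΓ : Γ.IsTree) {a b c q q' : V} (h1 : Btw Γ a q b) (h2 : Btw Γ b q c)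
    (h3 : Btw Γ a q c) (h1' : Btw Γ a q' b) (h2' : Btw Γ b q' c) (h3' : Btw Γ a q' c) :
    q = q' := by
  apply h1.eq_of_dist_eq hΓ h1'
  unfold Btw at *
  rw [Γ.dist_comm (u := q) (v := b)] at *
  rw [Γ.dist_comm (u := q') (v := b)] at *
  omega

theorem sep_subset (hΓ : Γ.IsTree) {a b b' : V} (h : Γ.Adj b' b) :
    Sep Γ a b ⊆ insert (b', b) (Sep Γ a b') := by
  rintro ⟨p, q⟩ ⟨hpq, ha, hb⟩
  by_cases hb' : Side Γ p q b'
  · exact Or.inr ⟨hpq, ha, hb'⟩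
  · obtain ⟨rfl, rfl⟩ := eq_of_side_of_not_side hΓ hpq h hb hb'
    exact Or.inl rfl

theorem sep_self (a : V) : Sep Γ a a = ∅ := by
  ext e
  simp only [Sep, Set.mem_ofPred_eq, Set.mem_empty_iff_false, iff_false]
  tauto

theorem sep_finite (hΓ : Γ.IsTree) (a b : V) : (Sep Γ a b).Finite := by
  obtain ⟨W, -⟩ := hΓ.1.exists_walk_length_eq_dist b a
  induction W with
  | nil => rw [sep_self]; exact Set.finite_empty
  | cons h W ih => exact (ih.insert _).subset (sep_subset hΓ h.symm)

theorem dist_le_ncard_sep (hΓ : Γ.IsTree) (a b : V) : Γ.dist a b ≤ (Sep Γ a b).ncard := by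
  induction hn : Γ.dist b a generalizing b with
  | zero => rw [Γ.dist_comm, hn]; exact Nat.zero_le _
  | succ n ih =>
    have hne : b ≠ a := by
      rintro rfl; simp at hn
    obtain ⟨b', hb', hs⟩ := exists_next hΓ hne
    have hs' := (side_iff hΓ hb' a).1 hs
    have h1 : Γ.dist b' a = n := by
      rw [Γ.dist_comm]; rw [Γ.dist_comm] at hn; omega
    have h2 := ih b' h1
    have hsub : insert (b', b) (Sep Γ a b') ⊆ Sep Γ a b := by
      rintro e (rfl | ⟨hpq, ha, hq⟩)
      · exact ⟨hb'.symm, fun h => (side_symm hΓ hb' a).1 h hs, side_right hb'.symm⟩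
      · refine ⟨hpq, ha, ?_⟩
        by_contra hb
        obtain ⟨h3, h4⟩ := eq_of_side_of_not_side hΓ hpq hb' hq hb
        rw [not_side_iff hΓ hpq, ← h3, ← h4] at ha
        omega
    have hnot : (b', b) ∉ Sep Γ a b' := by
      rintro ⟨_, _, h⟩
      exact not_side_left hb'.symm h
    have h5 := Set.ncard_le_ncard hsub (sep_finite hΓ a b)
    rw [Set.ncard_insert_of_notMem hnot (sep_finite hΓ a b')] at h5
    rw [Γ.dist_comm (u := a) (v := b)]
    rw [Γ.dist_comm (u := a) (v := b')] at h2
    omega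

theorem btw_finite (hΓ : Γ.IsTree) (a b : V) : {r | Btw Γ a r b}.Finite := by
  refine (((sep_finite hΓ a b).image Prod.snd).insert a).subset ?_
  intro r hr
  by_cases h : r = a
  · exact Or.inl h
  obtain ⟨p, hp, hs⟩ := exists_next hΓ h
  refine Or.inr ⟨(p, r), ⟨hp.symm, ?_, ?_⟩, rfl⟩
  · exact fun h => (side_symm hΓ hp a).1 h hs
  · rw [side_symm hΓ hp]
    intro hb
    exact not_side_left hp (Btw.side hΓ hp hr hs hb)

theorem isAcyclic_of_forall_cut (h : ∀ a b, Γ.Adj a b → ∃ χ : V → Prop, ¬ (χ a ↔ χ b) ∧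
    ∀ u v, Γ.Adj u v → s(u, v) ≠ s(a, b) → (χ u ↔ χ v)) : Γ.IsAcyclic := by
  rw [SimpleGraph.isAcyclic_iff_forall_adj_isBridge]
  intro a b hab
  rw [SimpleGraph.isBridge_iff]
  rintro ⟨W⟩
  obtain ⟨χ, h1, h2⟩ := h a b hab
  apply h1
  clear h1
  generalize hΓ' : Γ.deleteEdges {s(a, b)} = Γ' at W
  have h3 : ∀ u v, Γ'.Adj u v → (χ u ↔ χ v) := by
    intro u v huv
    subst hΓ'
    simp only [SimpleGraph.deleteEdges_adj] at huv
    exact h2 u v huv.1 huv.2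
  clear h2 hab hΓ'
  induction W with
  | nil => rfl
  | cons h W ih => exact (h3 _ _ h).trans ih

end Tree

/-! ### Cocycles on the flag complex of a finite generating set -/

section Walls

variable {G : Type*} [Group G]

/-- Adjacency in the Cayley graph of `G` with respect to `D`. -/
def Nbr (D : Set G) (x y : G) : Prop := x⁻¹ * y ∈ D

/-- A finite symmetric generating set `D` such that the flag complex of the Cayley graph has
trivial first cohomology with coefficients in `ZMod 2`. -/
structure IsAcyclicGen (D : Set G) : Prop where
  finite : D.Finite
  one_mem : 1 ∈ D
  inv_mem : ∀ d ∈ D, d⁻¹ ∈ D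
  closure_eq : Subgroup.closure D = ⊤
  exact : ∀ c : G → G → ZMod 2,
    (∀ x y z, Nbr D x y → Nbr D y z → Nbr D x z → c x y + c y z = c x z) →
    ∃ b : G → ZMod 2, ∀ x y, Nbr D x y → c x y = b x + b y

variable {D : Set G}

theorem Nbr.symm (hD : IsAcyclicGen D) {x y : G} (h : Nbr D x y) : Nbr D y x := by
  have := hD.inv_mem _ h
  simpa [Nbr] using this

theorem Nbr.refl (hD : IsAcyclicGen D) (x : G) : Nbr D x x := by
  simpa [Nbr] using hD.one_mem

theorem Nbr.smul {x y : G} (h : Nbr D x y) (g : G) : Nbr D (g * x) (g * y) := by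
  simpa [Nbr, mul_assoc] using h

theorem nbr_induction (hD : IsAcyclicGen D) {P : G → Prop} (x : G) (hx : P x)
    (step : ∀ w w', Nbr D w w' → P w → P w') (w : G) : P w := by
  have key : ∀ g ∈ Subgroup.closure D, P (x * g) := by
    intro g hg
    induction hg using Subgroup.closure_induction_right with
    | one => simpa using hx
    | mul_right g _ d hd ih =>
      refine step _ _ ?_ ih
      simpa [Nbr, mul_assoc] using hd
    | mul_inv_cancel g _ d hd ih =>
      refine step _ _ ?_ ih
      simpa [Nbr, mul_assoc] using hD.inv_mem _ hd
  have := key (x⁻¹ * w) (by rw [hD.closure_eq]; trivial)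
  simpa using this

/-- The oriented edges of the Cayley graph entering `Y`. -/
def Cob (D : Set G) (Y : Set G) : Set (G × G) := {c | Nbr D c.1 c.2 ∧ c.1 ∉ Y ∧ c.2 ∈ Y}

/-- Two edges entering `Y` which lie in a common triangle. -/
def Step (D : Set G) (Y : Set G) (c c' : G × G) : Prop :=
  c ∈ Cob D Y ∧ c' ∈ Cob D Y ∧
    ((c.1 = c'.1 ∧ Nbr D c.2 c'.2) ∨ (c.2 = c'.2 ∧ Nbr D c.1 c'.1))

/-- The track containing the edge `c`. -/
def Track (D : Set G) (Y : Set G) (c : G × G) : Set (G × G) :=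
  {c' | Relation.ReflTransGen (Step D Y) c c'}

/-- `Z` is bounded by a single track of `Y`. -/
def IsWall (D : Set G) (Y Z : Set G) : Prop := ∃ c ∈ Cob D Y, Cob D Z = Track D Y c

theorem Step.symm (hD : IsAcyclicGen D) {Y : Set G} {c c' : G × G} (h : Step D Y c c') :
    Step D Y c' c := by
  obtain ⟨h1, h2, h3⟩ := h
  refine ⟨h2, h1, ?_⟩
  rcases h3 with h3 | h3
  · exact Or.inl ⟨h3.1.symm, h3.2.symm hD⟩
  · exact Or.inr ⟨h3.1.symm, h3.2.symm hD⟩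

theorem mem_track_self {Y : Set G} (c : G × G) : c ∈ Track D Y c := Relation.ReflTransGen.refl

theorem track_subset {Y : Set G} {c : G × G} (hc : c ∈ Cob D Y) : Track D Y c ⊆ Cob D Y := by
  intro c' h
  rcases Relation.ReflTransGen.cases_tail h with rfl | ⟨_, _, h⟩
  · exact hc
  · exact h.2.1

theorem track_eq (hD : IsAcyclicGen D) {Y : Set G} {c c' : G × G} (h : c' ∈ Track D Y c) :
    Track D Y c' = Track D Y c := by
  have hs : Std.Symm (Step D Y) := ⟨fun _ _ h => h.symm hD⟩
  have h' : Relation.ReflTransGen (Step D Y) c' c := Relation.ReflTransGen.stdSymm.symm _ _ h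
  ext e
  exact ⟨fun he => Relation.ReflTransGen.trans h he, fun he => Relation.ReflTransGen.trans h' he⟩

theorem mem_track_of_step {Y : Set G} {c c' c'' : G × G} (h : c' ∈ Track D Y c)
    (hs : Step D Y c' c'') : c'' ∈ Track D Y c := Relation.ReflTransGen.tail h hs

theorem exists_cob_eq_track (hD : IsAcyclicGen D) {Y : Set G} {c₀ : G × G} (hc₀ : c₀ ∈ Cob D Y) :
    ∃ Z, Cob D Z = Track D Y c₀ := by
  classical
  set C := Track D Y c₀ with hC
  have hCY : C ⊆ Cob D Y := track_subset hc₀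
  have hl : ∀ x y z, x ∉ Y → y ∈ Y → z ∈ Y → Nbr D x y → Nbr D x z → Nbr D y z →
      ((x, y) ∈ C → (x, z) ∈ C) := fun x y z hx hy hz h1 h2 h3 h =>
    mem_track_of_step h ⟨hCY h, ⟨h2, hx, hz⟩, Or.inl ⟨rfl, h3⟩⟩
  have hr : ∀ x y z, x ∈ Y → y ∉ Y → z ∉ Y → Nbr D y x → Nbr D z x → Nbr D y z →
      ((y, x) ∈ C → (z, x) ∈ C) := fun x y z hx hy hz h1 h2 h3 h =>
    mem_track_of_step h ⟨hCY h, ⟨h2, hz, hx⟩, Or.inr ⟨rfl, h3⟩⟩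
  have hn : ∀ x y, (x, y) ∈ C → x ∉ Y ∧ y ∈ Y := fun x y h => (hCY h).2
  obtain ⟨b, hb⟩ := hD.exact (fun x y => if (x, y) ∈ C ∨ (y, x) ∈ C then 1 else 0) (by
    intro x y z hxy hyz hxz
    have hyx := hxy.symm hD
    have hzy := hyz.symm hD
    have hzx := hxz.symm hD
    have e1 : x ∉ Y → y ∈ Y → z ∈ Y → ((x, y) ∈ C ↔ (x, z) ∈ C) := fun a b c =>
      ⟨hl x y z a b c hxy hxz hyz, hl x z y a c b hxz hxy hzy⟩
    have e2 : y ∉ Y → x ∈ Y → z ∈ Y → ((y, x) ∈ C ↔ (y, z) ∈ C) := fun a b c =>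
      ⟨hl y x z a b c hyx hyz hxz, hl y z x a c b hyz hyx hzx⟩
    have e3 : z ∉ Y → x ∈ Y → y ∈ Y → ((z, x) ∈ C ↔ (z, y) ∈ C) := fun a b c =>
      ⟨hl z x y a b c hzx hzy hxy, hl z y x a c b hzy hzx hyx⟩
    have e4 : x ∈ Y → y ∉ Y → z ∉ Y → ((y, x) ∈ C ↔ (z, x) ∈ C) := fun a b c =>
      ⟨hr x y z a b c hyx hzx hyz, hr x z y a c b hzx hyx hzy⟩
    have e5 : y ∈ Y → x ∉ Y → z ∉ Y → ((x, y) ∈ C ↔ (z, y) ∈ C) := fun a b c =>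
      ⟨hr y x z a b c hxy hzy hxz, hr y z x a c b hzy hxy hzx⟩
    have e6 : z ∈ Y → x ∉ Y → y ∉ Y → ((x, z) ∈ C ↔ (y, z) ∈ C) := fun a b c =>
      ⟨hr z x y a b c hxz hyz hxy, hr z y x a c b hyz hxz hyx⟩
    have n1 := hn x y
    have n2 := hn y x
    have n3 := hn y z
    have n4 := hn z y
    have n5 := hn x z
    have n6 := hn z x
    have two : (1 : ZMod 2) + 1 = 0 := by decide
    clear hl hr hn hCY hC
    clear_value C
    by_cases hx : x ∈ Y <;> by_cases hy : y ∈ Y <;> by_cases hz : z ∈ Y <;>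
      simp only [hx, hy, hz, not_true_eq_false, not_false_eq_true, and_true, and_self,
        and_false, imp_false, imp_true_iff, forall_true_left] at * <;>
      simp only [*, or_false, false_or, if_false, add_zero, zero_add] <;>
      first
        | rfl
        | (split_ifs <;> simp [two]))
  have key : ∀ x y, Nbr D x y → (((x, y) ∈ C ∨ (y, x) ∈ C) ↔ b x ≠ b y) := by
    intro x y h
    have h1 := hb x y h
    have h2 : ∀ u v : ZMod 2, u ≠ v → u + v = 1 := by decide
    have h3 : ∀ u v : ZMod 2, u = v → u + v ≠ 1 := by decide
    constructor
    · intro h4 h5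
      simp only [h4, if_true] at h1
      exact h3 _ _ h5 h1.symm
    · intro h4
      by_contra h5
      simp only [h5, if_false] at h1
      rw [h2 _ _ h4] at h1
      exact absurd h1 (by decide)
  have hz2 : ∀ u v w : ZMod 2, u ≠ v → w ≠ v → u = w := by decide
  have hmem : ∀ c ∈ C, b c.1 = b c₀.1 ∧ b c.2 ≠ b c₀.1 := by
    intro c hc
    have h0 : b c₀.1 ≠ b c₀.2 := (key _ _ hc₀.1).1 (Or.inl (mem_track_self c₀))
    change Relation.ReflTransGen _ _ _ at hc
    induction hc with
    | refl => exact ⟨rfl, h0.symm⟩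
    | @tail c c' h1 h2 ih =>
      have h3 : c' ∈ C := Relation.ReflTransGen.tail h1 h2
      have h4 : b c'.1 ≠ b c'.2 := (key _ _ h2.2.1.1).1 (Or.inl h3)
      rcases h2.2.2 with ⟨h5, -⟩ | ⟨h5, -⟩
      · rw [← h5, ih.1] at h4 ⊢
        exact ⟨rfl, h4.symm⟩
      · rw [← h5] at h4 ⊢
        exact ⟨hz2 _ _ _ h4 ih.2.symm, ih.2⟩
  refine ⟨{x | b x ≠ b c₀.1}, ?_⟩
  ext ⟨x, y⟩
  constructor
  · rintro ⟨h1, h2, h3⟩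
    simp only [Set.mem_ofPred_eq, ne_eq, not_not] at h2 h3
    rcases (key x y h1).2 (by rw [h2]; exact fun h => h3 h.symm) with h4 | h4
    · exact h4
    · exact absurd (hmem _ h4).1 h3
  · intro h
    have := hmem _ h
    exact ⟨(hCY h).1, by simpa using this.1, this.2⟩

theorem eq_of_cob_eq (hD : IsAcyclicGen D) {Z Z' : Set G} (h : Cob D Z = Cob D Z')
    (hne : (Cob D Z).Nonempty) : Z = Z' := by
  obtain ⟨⟨x, y⟩, hc⟩ := hne
  have hc' := hc
  rw [h] at hc'
  have key : ∀ w, (w ∈ Z ↔ w ∈ Z') := by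
    refine nbr_induction hD x (by simp [hc.2.1, hc'.2.1]) ?_
    intro w w' hw ih
    have h1 : (w, w') ∈ Cob D Z ↔ (w, w') ∈ Cob D Z' := by rw [h]
    have h2 : (w', w) ∈ Cob D Z ↔ (w', w) ∈ Cob D Z' := by rw [h]
    simp only [Cob, Set.mem_ofPred_eq, hw, hw.symm hD, true_and] at h1 h2
    tauto
  exact Set.ext key

theorem IsWall.nonempty {Y Z : Set G} (h : IsWall D Y Z) : (Cob D Z).Nonempty := by
  obtain ⟨c, _, h⟩ := h
  exact ⟨c, h ▸ mem_track_self c⟩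

theorem IsWall.cob_subset {Y Z : Set G} (h : IsWall D Y Z) : Cob D Z ⊆ Cob D Y := by
  obtain ⟨c, hc, h⟩ := h
  exact h ▸ track_subset hc

theorem IsWall.cob_eq (hD : IsAcyclicGen D) {Y Z : Set G} (h : IsWall D Y Z) {c : G × G}
    (hc : c ∈ Cob D Z) : Cob D Z = Track D Y c := by
  obtain ⟨c₀, _, h⟩ := h
  rw [h] at hc ⊢
  exact (track_eq hD hc).symm

theorem IsWall.eq_of_mem (hD : IsAcyclicGen D) {Y Z Z' : Set G} (h : IsWall D Y Z)
    (h' : IsWall D Y Z') {c : G × G} (hc : c ∈ Cob D Z) (hc' : c ∈ Cob D Z') : Z = Z' :=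
  eq_of_cob_eq hD ((h.cob_eq hD hc).trans (h'.cob_eq hD hc').symm) h.nonempty

theorem exists_wall (hD : IsAcyclicGen D) {Y : Set G} {c : G × G} (hc : c ∈ Cob D Y) :
    ∃ Z, IsWall D Y Z ∧ c ∈ Cob D Z := by
  obtain ⟨Z, hZ⟩ := exists_cob_eq_track hD hc
  exact ⟨Z, ⟨c, hc, hZ⟩, hZ ▸ mem_track_self c⟩

theorem smul_mem_cob {Y : Set G} {c : G × G} (g : G) (h : c ∈ Cob D Y) :
    (g * c.1, g * c.2) ∈ Cob D (g • Y) := by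
  refine ⟨h.1.smul g, ?_, ?_⟩
  · change g • c.1 ∉ g • Y
    rw [Set.smul_mem_smul_set_iff]; exact h.2.1
  · change g • c.2 ∈ g • Y
    rw [Set.smul_mem_smul_set_iff]; exact h.2.2

theorem smul_mem_track {Y : Set G} {c c' : G × G} (g : G) (h : c' ∈ Track D Y c) :
    (g * c'.1, g * c'.2) ∈ Track D (g • Y) (g * c.1, g * c.2) := by
  change Relation.ReflTransGen _ _ _ at h
  induction h with
  | refl => exact mem_track_self _
  | tail _ h ih =>
    refine mem_track_of_step ih ⟨smul_mem_cob g h.1, smul_mem_cob g h.2.1, ?_⟩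
    rcases h.2.2 with h | h
    · exact Or.inl ⟨by simp [h.1], h.2.smul g⟩
    · exact Or.inr ⟨by simp [h.1], h.2.smul g⟩

theorem IsWall.smul {Y Z : Set G} (h : IsWall D Y Z) (g : G) :
    IsWall D (g • Y) (g • Z) := by
  obtain ⟨c, hc, h⟩ := h
  refine ⟨_, smul_mem_cob g hc, ?_⟩
  ext ⟨x, y⟩
  constructor
  · intro h1
    have h2 := smul_mem_cob g⁻¹ h1
    rw [inv_smul_smul, h] at h2
    simpa using smul_mem_track g h2
  · intro h1
    have h2 := smul_mem_track g⁻¹ h1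
    simp only [inv_smul_smul, inv_mul_cancel_left, Prod.mk.eta, ← h] at h2
    simpa using smul_mem_cob g h2

theorem IsWall.mem_iff (hD : IsAcyclicGen D) {Y Z : Set G} (h : IsWall D Y Z) {x y : G}
    (hxy : Nbr D x y) (hY : x ∈ Y ↔ y ∈ Y) : x ∈ Z ↔ y ∈ Z := by
  by_contra hne
  have h1 : (x, y) ∈ Cob D Z → (x, y) ∈ Cob D Y := fun h' => h.cob_subset h'
  have h2 : (y, x) ∈ Cob D Z → (y, x) ∈ Cob D Y := fun h' => h.cob_subset h'
  simp only [Cob, Set.mem_ofPred_eq, hxy, hxy.symm hD, true_and] at h1 h2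
  tauto

theorem even_ncard_symmDiff_singleton {α : Type*} {s : Set α} (hs : s.Finite) (a : α) {t : Set α}
    (ht : ∀ z, z ∈ t ↔ ¬ (z ∈ s ↔ z = a)) :
    t.Finite ∧ (Even t.ncard ↔ ¬ Even s.ncard) := by
  by_cases ha : a ∈ s
  · have h : t = s \ {a} := by
      ext z
      rw [ht]
      by_cases hz : z = a
      · subst hz; simp [ha]
      · simp [hz]
    subst h
    refine ⟨hs.sdiff, ?_⟩
    rw [← Set.ncard_sdiff_singleton_add_one ha hs, Nat.even_add_one, not_not]
  · have h : t = insert a s := by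
      ext z
      rw [ht]
      by_cases hz : z = a
      · subst hz; simp [ha]
      · simp [hz]
    subst h
    refine ⟨hs.insert a, ?_⟩
    rw [Set.ncard_insert_of_notMem ha hs, Nat.even_add_one]

theorem even_ncard_separating_walls (hD : IsAcyclicGen D) (Y : Set G) (x w : G) :
    {Z | IsWall D Y Z ∧ ¬ (x ∈ Z ↔ w ∈ Z)}.Finite ∧
      (Even {Z | IsWall D Y Z ∧ ¬ (x ∈ Z ↔ w ∈ Z)}.ncard ↔ (x ∈ Y ↔ w ∈ Y)) := by
  refine nbr_induction hD (P := fun w => {Z | IsWall D Y Z ∧ ¬ (x ∈ Z ↔ w ∈ Z)}.Finite ∧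
      (Even {Z | IsWall D Y Z ∧ ¬ (x ∈ Z ↔ w ∈ Z)}.ncard ↔ (x ∈ Y ↔ w ∈ Y))) x (by simp) ?_ w
  rintro w w' hw ⟨hfin, heven⟩
  by_cases hY : w ∈ Y ↔ w' ∈ Y
  · have : {Z | IsWall D Y Z ∧ ¬ (x ∈ Z ↔ w' ∈ Z)} = {Z | IsWall D Y Z ∧ ¬ (x ∈ Z ↔ w ∈ Z)} := by
      ext Z
      simp only [Set.mem_ofPred_eq, and_congr_right_iff]
      intro hZ
      rw [hZ.mem_iff hD hw hY]
    rw [this, ← hY]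
    exact ⟨hfin, heven⟩
  · have hZ₀ : ∃ Z₀, IsWall D Y Z₀ ∧ ∀ Z, IsWall D Y Z → ((w ∈ Z ↔ w' ∈ Z) ↔ ¬ Z = Z₀) := by
      have hor : (w, w') ∈ Cob D Y ∨ (w', w) ∈ Cob D Y := by
        simp only [Cob, Set.mem_ofPred_eq, hw, hw.symm hD, true_and]
        tauto
      rcases hor with hc | hc
      · obtain ⟨Z₀, h0, hc0⟩ := exists_wall hD hc
        refine ⟨Z₀, h0, fun Z hZ => ?_⟩
        constructor
        · rintro h rfl
          exact hc0.2.1 (h.2 hc0.2.2)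
        · intro hne
          by_contra h
          have h1 : (w', w) ∈ Cob D Z → (w', w) ∈ Cob D Y := fun h' => hZ.cob_subset h'
          have h2 : (w, w') ∉ Cob D Z := fun h' => hne (hZ.eq_of_mem hD h0 h' hc0)
          have := hc.2
          simp only [Cob, Set.mem_ofPred_eq, hw, hw.symm hD, true_and] at h1 h2 this
          tauto
      · obtain ⟨Z₀, h0, hc0⟩ := exists_wall hD hc
        refine ⟨Z₀, h0, fun Z hZ => ?_⟩
        constructor
        · rintro h rfl
          exact hc0.2.1 (h.1 hc0.2.2)
        · intro hne
          by_contra h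
          have h1 : (w, w') ∈ Cob D Z → (w, w') ∈ Cob D Y := fun h' => hZ.cob_subset h'
          have h2 : (w', w) ∉ Cob D Z := fun h' => hne (hZ.eq_of_mem hD h0 h' hc0)
          have := hc.2
          simp only [Cob, Set.mem_ofPred_eq, hw, hw.symm hD, true_and] at h1 h2 this
          tauto
    obtain ⟨Z₀, h0, h1⟩ := hZ₀
    have h2 := even_ncard_symmDiff_singleton hfin Z₀
      (t := {Z | IsWall D Y Z ∧ ¬ (x ∈ Z ↔ w' ∈ Z)}) (by
        intro Z
        simp only [Set.mem_ofPred_eq]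
        by_cases hZ : IsWall D Y Z
        · have := h1 Z hZ
          tauto
        · have : Z ≠ Z₀ := by rintro rfl; exact hZ h0
          tauto)
    refine ⟨h2.1, h2.2.trans ?_⟩
    rw [heven]
    tauto

theorem exists_separating_wall (hD : IsAcyclicGen D) {Y : Set G} {x w : G}
    (h : ¬ (x ∈ Y ↔ w ∈ Y)) : ∃ Z, IsWall D Y Z ∧ ¬ (x ∈ Z ↔ w ∈ Z) := by
  by_contra hne
  have h1 := (even_ncard_separating_walls hD Y x w).2
  have h2 : {Z | IsWall D Y Z ∧ ¬ (x ∈ Z ↔ w ∈ Z)} = ∅ := by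
    ext Z
    simp only [Set.mem_ofPred_eq, Set.mem_empty_iff_false, iff_false]
    exact fun h => hne ⟨Z, h⟩
  rw [h2] at h1
  simp at h1
  exact h h1

end Walls

section Presentation

variable {G : Type*} [Group G]

/-- The images of the words of length at most `L`. -/
def wordBall {n : ℕ} (φ : FreeGroup (Fin n) →* G) (L : ℕ) : Set G :=
  (fun w => φ (FreeGroup.mk w)) '' {w : List (Fin n × Bool) | w.length ≤ L}

theorem wordBall_inv {n : ℕ} {φ : FreeGroup (Fin n) →* G} {L : ℕ} {d : G} (hd : d ∈ wordBall φ L) :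
    d⁻¹ ∈ wordBall φ L := by
  obtain ⟨w, hw, rfl⟩ := hd
  refine ⟨FreeGroup.invRev w, ?_, ?_⟩
  · simpa using hw
  · simp only [← FreeGroup.inv_mk, map_inv]

theorem isAcyclicGen_wordBall {n : ℕ} {φ : FreeGroup (Fin n) →* G} (hφ : Function.Surjective φ)
    {rels : Set (FreeGroup (Fin n))} (hker : φ.ker = Subgroup.normalClosure rels) {L : ℕ}
    (hL : 1 ≤ L) (hrels : ∀ r ∈ rels, r.toWord.length ≤ L) : IsAcyclicGen (wordBall φ L) where
  finite := (List.finite_length_le _ L).image _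
  one_mem := ⟨[], by simp, map_one φ⟩
  inv_mem _ hd := wordBall_inv hd
  closure_eq := by
    rw [eq_top_iff]
    rintro g -
    obtain ⟨w, rfl⟩ := hφ g
    induction w using FreeGroup.induction_on with
    | C1 => simp
    | of i => exact Subgroup.subset_closure ⟨[(i, true)], by simpa using hL, rfl⟩
    | inv_of i h => simpa using inv_mem h
    | mul a b ha hb => simpa using mul_mem ha hb
  exact := by
    intro c hc
    have h1 : (1 : G) ∈ wordBall φ L := ⟨[], by simp, map_one φ⟩
    have hrefl : ∀ x, c x x = 0 := by
      intro x
      have hx : Nbr (wordBall φ L) x x := by simpa [Nbr] using h1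
      simpa using hc x x x hx hx hx
    have hsymm : ∀ x y, Nbr (wordBall φ L) x y → c x y + c y x = 0 := by
      intro x y hxy
      have hx : Nbr (wordBall φ L) x x := by simpa [Nbr] using h1
      have hyx : Nbr (wordBall φ L) y x := by simpa [Nbr] using wordBall_inv hxy
      rw [hc x y x hxy hyx hx, hrefl]
    have hgen : ∀ i, φ (FreeGroup.of i) ∈ wordBall φ L := fun i =>
      ⟨[(i, true)], by simpa using hL, rfl⟩
    let σ : Fin n → Equiv.Perm (G × ZMod 2) := fun i =>
      ⟨fun p => (p.1 * (φ (FreeGroup.of i))⁻¹, p.2 + c p.1 (p.1 * (φ (FreeGroup.of i))⁻¹)),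
        fun p => (p.1 * φ (FreeGroup.of i), p.2 + c p.1 (p.1 * φ (FreeGroup.of i))), by
          intro p
          have := hsymm p.1 (p.1 * (φ (FreeGroup.of i))⁻¹)
            (by simpa [Nbr] using wordBall_inv (hgen i))
          ext <;> simp [add_assoc, this], by
          intro p
          have := hsymm p.1 (p.1 * φ (FreeGroup.of i)) (by simpa [Nbr] using hgen i)
          ext <;> simp [add_assoc, this]⟩
    let θ : FreeGroup (Fin n) →* Equiv.Perm (G × ZMod 2) := FreeGroup.lift σ
    have hfst : ∀ w p, (θ w p).1 = p.1 * (φ w)⁻¹ := by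
      intro w
      induction w using FreeGroup.induction_on with
      | C1 => simp
      | of i => intro p; simp [θ, σ]
      | inv_of i h =>
        intro p
        rw [map_inv, map_inv, inv_inv]
        simp [θ, σ, Equiv.Perm.inv_def]
      | mul a b ha hb => intro p; simp [ha, hb, mul_assoc]
    have hsnd : ∀ w : List (Fin n × Bool), w.length ≤ L → ∀ p,
        (θ (FreeGroup.mk w) p).2 = p.2 + c p.1 (p.1 * (φ (FreeGroup.mk w))⁻¹) := by
      intro w
      induction w with
      | nil => intro _ p; simp [← FreeGroup.one_eq_mk, hrefl]
      | cons a w ih =>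
        intro hw p
        have hw' : w.length ≤ L := by simp at hw; omega
        have hcons : FreeGroup.mk (a :: w) = FreeGroup.mk [a] * FreeGroup.mk w := by
          simp [FreeGroup.mul_mk]
        have hone : ∀ p, (θ (FreeGroup.mk [a]) p).2 = p.2 + c p.1 (p.1 * (φ (FreeGroup.mk [a]))⁻¹) := by
          intro p
          obtain ⟨i, b⟩ := a
          cases b
          · have : (FreeGroup.mk [(i, false)]) = (FreeGroup.of i)⁻¹ := by
              simp [FreeGroup.of, FreeGroup.inv_mk, FreeGroup.invRev]
            rw [this, map_inv, map_inv, inv_inv]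
            simp [θ, σ, Equiv.Perm.inv_def]
          · change (θ (FreeGroup.of i) p).2 = _ + c _ (p.1 * (φ (FreeGroup.of i))⁻¹)
            simp [θ, σ]
        have hmem : ∀ v : List (Fin n × Bool), v.length ≤ L → (φ (FreeGroup.mk v))⁻¹ ∈ wordBall φ L :=
          fun v hv => wordBall_inv ⟨v, hv, rfl⟩
        have hd1 := hmem w hw'
        have hd2 := hmem [a] (by simpa using hL)
        have hd3 := hmem (a :: w) hw
        rw [hcons, map_mul, Equiv.Perm.mul_apply, hone, hfst, ih hw', add_assoc, map_mul, mul_inv_rev,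
          ← mul_assoc p.1]
        congr 1
        refine hc _ _ _ (by simpa [Nbr] using hd1) (by simpa [Nbr, mul_assoc] using hd2) ?_
        rw [hcons, map_mul, mul_inv_rev] at hd3
        simpa [Nbr, mul_assoc] using hd3
    have hkerθ : φ.ker ≤ θ.ker := by
      rw [hker]
      refine Subgroup.normalClosure_le_normal fun r hr => ?_
      have hφr : φ r = 1 := by
        rw [← MonoidHom.mem_ker, hker]
        exact Subgroup.subset_normalClosure hr
      have h2 := hsnd r.toWord (hrels r hr)
      have h3 := hfst r
      rw [FreeGroup.mk_toWord] at h2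
      rw [SetLike.mem_coe, MonoidHom.mem_ker]
      ext p
      · simp [h3, hφr]
      · simp [h2, hφr, hrefl]
    choose w hw using fun x : G => hφ x⁻¹
    refine ⟨fun x => (θ (w x) (1, 0)).2, fun x y hxy => ?_⟩
    obtain ⟨v, hv, hvd⟩ := wordBall_inv hxy
    have h2 : θ (FreeGroup.mk v * w x) = θ (w y) := by
      have h3 : (w y)⁻¹ * (FreeGroup.mk v * w x) ∈ φ.ker := by
        simp only at hvd
        simp [MonoidHom.mem_ker, hw, hvd]
      have h4 := hkerθ h3
      rw [MonoidHom.mem_ker, map_mul, map_inv, inv_mul_eq_one] at h4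
      exact h4.symm
    simp only at hvd
    have h3 : (θ (w y) (1, 0)).2 = (θ (w x) (1, 0)).2 + c x y := by
      rw [← h2, map_mul, Equiv.Perm.mul_apply, hsnd v hv, hfst, hvd, hw]
      simp
    have h4 : ∀ a b : ZMod 2, b = a + (a + b) := by decide
    change c x y = (θ (w x) (1, 0)).2 + (θ (w y) (1, 0)).2
    rw [h3]
    exact h4 _ _

theorem exists_isAcyclicGen {G : Type*} [Group G] (h : FinitelyPresentedGroup G) :
    ∃ D : Set G, IsAcyclicGen D := by
  obtain ⟨n, rels, hfin, ⟨e⟩⟩ := h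
  obtain ⟨M, hM⟩ := (hfin.image fun r => r.toWord.length).bddAbove
  refine ⟨_, isAcyclicGen_wordBall (φ := e.toMonoidHom.comp (PresentedGroup.mk rels))
    (e.surjective.comp (PresentedGroup.mk_surjective rels)) (rels := rels) ?_
    (L := M + 1) (by omega) ?_⟩
  · ext w
    simp [MonoidHom.mem_ker, PresentedGroup.mk_eq_one_iff]
  · intro r hr
    have := hM ⟨r, hr, rfl⟩
    simp only at this
    omega

end Presentation

/-! ### Walls dual to a tree action -/

section TreeAction

/-- An action on a tree by automorphisms and without inversions. -/
class IsTreeAction (G : Type*) [Group G] {V : Type*} [MulAction G V] (Γ : SimpleGraph V) :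
    Prop where
  isTree : Γ.IsTree
  adj_smul : ∀ (g : G) (a b : V), Γ.Adj a b → Γ.Adj (g • a) (g • b)
  noInversion : ∀ (g : G) (a b : V), Γ.Adj a b → ¬ (g • a = b ∧ g • b = a)

variable {G : Type*} [Group G] {V : Type*} [MulAction G V] {Γ : SimpleGraph V}

theorem IsTreeAction.adj_smul_iff (h : IsTreeAction G Γ) (g : G) (a b : V) :
    Γ.Adj (g • a) (g • b) ↔ Γ.Adj a b :=
  ⟨fun h' => by simpa using h.adj_smul g⁻¹ _ _ h', h.adj_smul g a b⟩

theorem IsTreeAction.dist_smul_le (h : IsTreeAction G Γ) (g : G) (a b : V) :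
    Γ.dist (g • a) (g • b) ≤ Γ.dist a b := by
  obtain ⟨w, hw⟩ := h.isTree.connected.exists_walk_length_eq_dist a b
  let f : Γ →g Γ := ⟨fun v => g • v, fun {a b} h' => h.adj_smul g a b h'⟩
  have := SimpleGraph.dist_le (w.map f)
  rw [SimpleGraph.Walk.length_map, hw] at this
  exact this

theorem IsTreeAction.dist_smul (h : IsTreeAction G Γ) (g : G) (a b : V) :
    Γ.dist (g • a) (g • b) = Γ.dist a b := by
  refine le_antisymm (h.dist_smul_le g a b) ?_
  simpa using h.dist_smul_le g⁻¹ (g • a) (g • b)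

theorem IsTreeAction.side_smul (h : IsTreeAction G Γ) (g : G) (p q v : V) :
    Side Γ (g • p) (g • q) (g • v) ↔ Side Γ p q v := by
  simp only [Side, h.dist_smul]

theorem IsTreeAction.btw_smul (h : IsTreeAction G Γ) (g : G) (p q v : V) :
    Btw Γ (g • p) (g • q) (g • v) ↔ Btw Γ p q v := by
  simp only [Btw, h.dist_smul]

/-- The group elements moving `v₀` to the `q`-side of the edge `(p, q)`. -/
def Half (G : Type*) [Group G] [MulAction G V] (Γ : SimpleGraph V) (v₀ p q : V) : Set G :=
  {g | Side Γ p q (g • v₀)}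

theorem mem_half {v₀ p q : V} {g : G} : g ∈ Half G Γ v₀ p q ↔ Side Γ p q (g • v₀) := Iff.rfl

theorem IsTreeAction.half_smul (h : IsTreeAction G Γ) (g : G) (v₀ p q : V) :
    Half G Γ v₀ (g • p) (g • q) = g • Half G Γ v₀ p q := by
  ext x
  rw [Set.mem_smul_set_iff_inv_smul_mem, mem_half, mem_half, ← h.side_smul g p q, smul_eq_mul,
    mul_smul, smul_inv_smul]

/-- The walls of the half-spaces of a tree. -/
def Walls (D : Set G) (Γ : SimpleGraph V) (v₀ : V) : Set (Set G) :=
  {Z | ∃ p q, Γ.Adj p q ∧ IsWall D (Half G Γ v₀ p q) Z}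

variable {D : Set G} {v₀ : V}

theorem IsTreeAction.smul_mem_walls (h : IsTreeAction G Γ) (g : G) {Z : Set G}
    (hZ : Z ∈ Walls D Γ v₀) : g • Z ∈ Walls D Γ v₀ := by
  obtain ⟨p, q, hpq, hZ⟩ := hZ
  refine ⟨g • p, g • q, h.adj_smul g p q hpq, ?_⟩
  rw [h.half_smul]
  exact hZ.smul g

theorem mem_sep_of_cob {p q : V} (hpq : Γ.Adj p q) {c : G × G}
    (hc : c ∈ Cob D (Half G Γ v₀ p q)) : (p, q) ∈ Sep Γ (c.1 • v₀) (c.2 • v₀) :=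
  ⟨hpq, hc.2.1, hc.2.2⟩

theorem finite_edges_of_wall (hΓ : Γ.IsTree) (v₀ : V) (Z : Set G) :
    {e : V × V | Γ.Adj e.1 e.2 ∧ IsWall D (Half G Γ v₀ e.1 e.2) Z}.Finite := by
  by_cases hZ : (Cob D Z).Nonempty
  · obtain ⟨c, hc⟩ := hZ
    exact (sep_finite hΓ _ _).subset fun e he => mem_sep_of_cob he.1 (he.2.cob_subset hc)
  · convert Set.finite_empty
    ext e
    simp only [Set.mem_ofPred_eq, Set.mem_empty_iff_false, iff_false]
    exact fun he => hZ he.2.nonempty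

theorem finite_walls_of_mem_cob (hD : IsAcyclicGen D) (hΓ : Γ.IsTree) (v₀ : V) (c : G × G) :
    {Z | Z ∈ Walls D Γ v₀ ∧ c ∈ Cob D Z}.Finite := by
  refine ((sep_finite hΓ (c.1 • v₀) (c.2 • v₀)).biUnion
    (t := fun e => {Z | IsWall D (Half G Γ v₀ e.1 e.2) Z ∧ c ∈ Cob D Z}) fun e _ => ?_).subset ?_
  · exact Set.Subsingleton.finite fun Z hZ Z' hZ' => hZ.1.eq_of_mem hD hZ'.1 hZ.2 hZ'.2
  · rintro Z ⟨⟨p, q, hpq, hZ⟩, hc⟩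
    exact Set.mem_biUnion (mem_sep_of_cob hpq (hZ.cob_subset hc)) ⟨hZ, hc⟩

/-- The triangle `x, y, z` is crossed by the wall `Z` of a half-space `(p, q)` such that `q` is the
median of the images of `x`, `y`, `z`. -/
def IsLast (D : Set G) (Γ : SimpleGraph V) (v₀ : V) (x y z : G) (Z : Set G) : Prop :=
  ∃ p q, Γ.Adj p q ∧ IsWall D (Half G Γ v₀ p q) Z ∧ (x, y) ∈ Cob D Z ∧ Nbr D x z ∧
    z ∈ Half G Γ v₀ p q ∧ ¬ ∃ r, Γ.Adj q r ∧ y ∈ Half G Γ v₀ q r ∧ z ∈ Half G Γ v₀ q r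

theorem IsLast.unique (hD : IsAcyclicGen D) (hΓ : Γ.IsTree) {x y z : G} {Z Z' : Set G}
    (h : IsLast D Γ v₀ x y z Z) (h' : IsLast D Γ v₀ x y z Z') : Z = Z' := by
  obtain ⟨p, q, hpq, hZ, hc, -, hz, hl⟩ := h
  obtain ⟨p', q', hpq', hZ', hc', -, hz', hl'⟩ := h'
  have hY := hZ.cob_subset hc
  have hY' := hZ'.cob_subset hc'
  have hq : q = q' := by
    refine median_unique hΓ (btw_of_sep hΓ hpq hY.2.1 hY.2.2).2 ?_
      (btw_of_sep hΓ hpq hY.2.1 hz).2 (btw_of_sep hΓ hpq' hY'.2.1 hY'.2.2).2 ?_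
      (btw_of_sep hΓ hpq' hY'.2.1 hz').2
    · by_contra hb
      exact hl (exists_next_of_not_btw hΓ hb)
    · by_contra hb
      exact hl' (exists_next_of_not_btw hΓ hb)
  subst hq
  have hp : p = p' := next_unique hΓ hpq.symm hpq'.symm
    ((side_symm hΓ hpq _).2 hY.2.1) ((side_symm hΓ hpq' _).2 hY'.2.1)
  subst hp
  exact hZ.eq_of_mem hD hZ' hc hc'

theorem not_side_of_side (hΓ : Γ.IsTree) {p q r v w : V} (hpq : Γ.Adj p q) (hqr : Γ.Adj q r)
    (hv : ¬ Side Γ p q v) (hw : Side Γ p q w) (hw' : Side Γ q r w) : ¬ Side Γ q r v := by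
  intro h
  have := next_unique hΓ hqr hpq.symm h ((side_symm hΓ hpq _).2 hv)
  subst this
  exact (side_symm hΓ hpq _).1 hw' hw

theorem exists_isLast_aux (hD : IsAcyclicGen D) (hΓ : Γ.IsTree) {x₀ y₀ : G} {Z : Set G}
    (hc₀ : (x₀, y₀) ∈ Cob D Z) (n : ℕ) : ∀ p q, Γ.Adj p q → IsWall D (Half G Γ v₀ p q) Z →
      Γ.dist (y₀ • v₀) q ≤ n → ∃ x y z, IsLast D Γ v₀ x y z Z := by
  induction n with
  | zero =>
    intro p q hpq hZ hd
    refine ⟨x₀, y₀, y₀, p, q, hpq, hZ, hc₀, hc₀.1, (hZ.cob_subset hc₀).2.2, ?_⟩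
    rintro ⟨r, -, h, -⟩
    rw [mem_half, Side] at h
    omega
  | succ n ih =>
    intro p q hpq hZ hd
    by_contra hne
    have h : ∀ x y z, (x, y) ∈ Cob D Z → Nbr D x z → z ∈ Half G Γ v₀ p q →
        ∃ r, Γ.Adj q r ∧ y ∈ Half G Γ v₀ q r ∧ z ∈ Half G Γ v₀ q r := by
      intro x y z h1 h2 h3
      by_contra h4
      exact hne ⟨x, y, z, p, q, hpq, hZ, h1, h2, h3, h4⟩
    have hY := hZ.cob_subset hc₀
    obtain ⟨r, hqr, hy₀, -⟩ := h x₀ y₀ y₀ hc₀ hc₀.1 hY.2.2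
    have htr := hZ.cob_eq hD hc₀
    have hxr : ∀ x, x ∉ Half G Γ v₀ p q → x ∉ Half G Γ v₀ q r := fun x hx =>
      not_side_of_side hΓ hpq hqr hx hY.2.2 hy₀
    have hc₀' : (x₀, y₀) ∈ Cob D (Half G Γ v₀ q r) := ⟨hc₀.1, hxr _ hY.2.1, hy₀⟩
    have hA : ∀ c ∈ Cob D Z, c.2 ∈ Half G Γ v₀ q r ∧ c ∈ Track D (Half G Γ v₀ q r) (x₀, y₀) := by
      intro c hc
      rw [htr] at hc
      change Relation.ReflTransGen _ _ _ at hc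
      induction hc with
      | refl => exact ⟨hy₀, mem_track_self _⟩
      | @tail c c' h1 h2 ih =>
        have hcZ : c ∈ Cob D Z := by rw [htr]; exact h1
        have hy' : c'.2 ∈ Half G Γ v₀ q r := by
          rcases h2.2.2 with ⟨h3, h4⟩ | ⟨h3, h4⟩
          · obtain ⟨r', hqr', h5, h6⟩ := h c.1 c.2 c'.2 hcZ (h3 ▸ h2.2.1.1) h2.2.1.2.2
            rwa [next_unique hΓ hqr hqr' ih.1 h5]
          · exact h3 ▸ ih.1
        exact ⟨hy', mem_track_of_step ih.2 ⟨⟨h2.1.1, hxr _ h2.1.2.1, ih.1⟩,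
          ⟨h2.2.1.1, hxr _ h2.2.1.2.1, hy'⟩, h2.2.2⟩⟩
    refine hne (ih q r hqr ⟨_, hc₀', Set.Subset.antisymm (fun c hc => (hA c hc).2) ?_⟩ ?_)
    · intro c hc
      change Relation.ReflTransGen _ _ _ at hc
      induction hc with
      | refl => exact hc₀
      | @tail c c' h1 h2 ih =>
        have hcY := hZ.cob_subset ih
        have hy' : c'.2 ∈ Half G Γ v₀ p q := by
          by_contra h3
          exact hxr _ h3 h2.2.1.2.2
        have hx' : c'.1 ∉ Half G Γ v₀ p q := by
          rcases h2.2.2 with ⟨h3, h4⟩ | ⟨h3, h4⟩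
          · exact h3 ▸ hcY.2.1
          · intro h5
            obtain ⟨r', hqr', h6, h7⟩ := h c.1 c.2 c'.1 ih h4 h5
            rw [next_unique hΓ hqr' hqr h6 h2.1.2.2] at h7
            exact h2.2.1.2.1 h7
        rw [htr] at ih ⊢
        exact mem_track_of_step ih ⟨hcY, ⟨h2.2.1.1, hx', hy'⟩, h2.2.2⟩
    · have : Γ.dist (y₀ • v₀) r < Γ.dist (y₀ • v₀) q := hy₀
      omega

theorem exists_isLast (hD : IsAcyclicGen D) (hΓ : Γ.IsTree) {Z : Set G} (hZ : Z ∈ Walls D Γ v₀) :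
    ∃ x y z, IsLast D Γ v₀ x y z Z := by
  obtain ⟨p, q, hpq, hZ⟩ := hZ
  obtain ⟨⟨x₀, y₀⟩, hc₀⟩ := hZ.nonempty
  exact exists_isLast_aux hD hΓ hc₀ _ p q hpq hZ le_rfl

theorem IsTreeAction.isLast_smul (h : IsTreeAction G Γ) (g : G) {x y z : G} {Z : Set G}
    (hl : IsLast D Γ v₀ x y z Z) : IsLast D Γ v₀ (g * x) (g * y) (g * z) (g • Z) := by
  obtain ⟨p, q, hpq, hZ, hc, hxz, hz, hl⟩ := hl
  refine ⟨g • p, g • q, h.adj_smul g p q hpq, ?_, smul_mem_cob g hc, hxz.smul g, ?_, ?_⟩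
  · rw [h.half_smul]; exact hZ.smul g
  · rwa [mem_half, mul_smul, h.side_smul]
  · rintro ⟨r, h1, h2, h3⟩
    obtain ⟨r, rfl⟩ : ∃ s, g • s = r := ⟨g⁻¹ • r, by simp⟩
    rw [mem_half, mul_smul, h.side_smul] at h2 h3
    exact hl ⟨r, (h.adj_smul_iff g _ _).1 h1, h2, h3⟩

/-- The orbits of walls. -/
def WallOrbits (D : Set G) (Γ : SimpleGraph V) (v₀ : V) : Set (Set (Set G)) :=
  (fun Z => MulAction.orbit G Z) '' Walls D Γ v₀

theorem IsTreeAction.wallOrbits_bound (h : IsTreeAction G Γ) (hD : IsAcyclicGen D) (v₀ : V) :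
    (WallOrbits D Γ v₀).Finite ∧ (WallOrbits D Γ v₀).ncard ≤ (D ×ˢ D).ncard := by
  have key : ∀ O : Set (Set G), O ∈ WallOrbits D Γ v₀ →
      ∃ e : G × G, e ∈ D ×ˢ D ∧ ∃ Z, O = MulAction.orbit G Z ∧ IsLast D Γ v₀ 1 e.1 e.2 Z := by
    rintro O ⟨Z, hZ, rfl⟩
    obtain ⟨x, y, z, hl⟩ := exists_isLast hD h.isTree hZ
    have hl' := h.isLast_smul x⁻¹ hl
    rw [inv_mul_cancel] at hl'
    obtain ⟨p, q, -, -, hc, hz, -⟩ := hl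
    exact ⟨(x⁻¹ * y, x⁻¹ * z), ⟨hc.1, hz⟩, x⁻¹ • Z, (MulAction.orbit_smul _ _).symm, hl'⟩
  choose! F hF using key
  have hfin : (D ×ˢ D).Finite := hD.finite.prod hD.finite
  have hinj : Set.InjOn F (WallOrbits D Γ v₀) := by
    intro O hO O' hO' heq
    obtain ⟨Z, rfl, hZ⟩ := (hF O hO).2
    obtain ⟨Z', rfl, hZ'⟩ := (hF O' hO').2
    rw [heq] at hZ
    rw [hZ.unique hD h.isTree hZ']
  exact ⟨Set.Finite.of_injOn (fun O hO => (hF O hO).1) hinj hfin,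
    Set.ncard_le_ncard_of_injOn F (fun O hO => (hF O hO).1) hinj hfin⟩

end TreeAction

section Center

variable {G : Type*} [Group G] {V : Type*} [MulAction G V] {Γ : SimpleGraph V}

/-- A subgroup with a bounded orbit fixes a vertex. -/
theorem IsTreeAction.exists_fixed_of_bounded (h : IsTreeAction G Γ) (H : Subgroup G) (a : V)
    (N : ℕ) (hN : ∀ g ∈ H, Γ.dist a (g • a) ≤ N) : ∃ v : V, ∀ g ∈ H, g • v = v := by
  classical
  have hΓ := h.isTree
  have hex : ∃ n, ∃ v, ∀ g ∈ H, Γ.dist v (g • a) ≤ n := ⟨N, a, hN⟩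
  set n := Nat.find hex with hn
  have hmin : ∀ m v, (∀ g ∈ H, Γ.dist v (g • a) ≤ m) → n ≤ m := fun m v hv =>
    Nat.find_min' hex ⟨v, hv⟩
  have hclose : ∀ v w, (∀ g ∈ H, Γ.dist v (g • a) ≤ n) → (∀ g ∈ H, Γ.dist w (g • a) ≤ n) →
      Γ.dist v w ≤ 1 := by
    intro v w hv hw
    by_contra hd
    have hne : v ≠ w := by rintro rfl; simp at hd
    obtain ⟨r, hvr, hr⟩ := exists_next hΓ hne
    have h1 := (btw_of_sep hΓ hvr (not_side_left hvr) hr).2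
    have hvr1 : Γ.dist v r = 1 := SimpleGraph.dist_eq_one_iff_adj.2 hvr
    have h2 : ∀ g ∈ H, Γ.dist r (g • a) + 1 ≤ n := by
      intro g hg
      have h3 := hv g hg
      have h4 := hw g hg
      have h5 := h1
      rcases h1.or hΓ (g • a) with h6 | h6
      · rw [Btw] at h6
        omega
      · rw [Btw] at h5 h6
        rw [SimpleGraph.dist_comm (u := w), ← h6, SimpleGraph.dist_comm (u := g • a)] at h4
        omega
    have h3 := hmin (n - 1) r fun g hg => by have := h2 g hg; omega
    have h4 := h2 1 H.one_mem
    omega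
  obtain ⟨v, hv⟩ : ∃ v, ∀ g ∈ H, Γ.dist v (g • a) ≤ n := Nat.find_spec hex
  have horb : ∀ g ∈ H, ∀ k ∈ H, Γ.dist (g • v) (k • a) ≤ n := by
    intro g hg k hk
    have := hv (g⁻¹ * k) (H.mul_mem (H.inv_mem hg) hk)
    rwa [← h.dist_smul g, ← mul_smul, mul_inv_cancel_left] at this
  by_cases hfix : ∀ g ∈ H, g • v = v
  · exact ⟨v, hfix⟩
  · exfalso
    push Not at hfix
    obtain ⟨g, hg, hgv⟩ := hfix
    have hadj : ∀ u w : V, u ≠ w → Γ.dist u w ≤ 1 → Γ.dist u w = 1 := by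
      intro u w hne hd
      have := hΓ.connected.pos_dist_of_ne hne
      omega
    have h1 := hadj _ _ (Ne.symm hgv) (hclose _ _ hv (horb g hg))
    have hA := SimpleGraph.dist_eq_one_iff_adj.1 h1
    have h2 : Γ.dist (g • g • v) (g • v) = 1 := by
      rw [h.dist_smul, SimpleGraph.dist_comm]; exact h1
    have h3 := hclose _ _ (horb (g * g) (H.mul_mem hg hg)) hv
    rw [mul_smul] at h3
    have h4 : g • g • v = v := by
      by_contra hne
      have h5 := hadj _ _ hne h3
      by_cases hs : Side Γ v (g • v) (g • g • v)
      · rw [side_iff hΓ hA] at hs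
        omega
      · rw [not_side_iff hΓ hA] at hs
        omega
    exact h.noInversion g v (g • v) hA ⟨rfl, h4⟩

end Center

section Refinement

theorem side_iff_of_cut {V : Type*} {Γ : SimpleGraph V} (hΓ : Γ.IsTree) {a b : V} (hab : Γ.Adj a b)
    {χ : V → Prop} (ha : ¬ χ a) (hb : χ b)
    (hχ : ∀ u v, Γ.Adj u v → s(u, v) ≠ s(a, b) → (χ u ↔ χ v)) (v : V) : Side Γ a b v ↔ χ v := by
  obtain ⟨w⟩ := hΓ.connected.preconnected v a
  induction w with
  | nil => exact iff_of_false (not_side_left hab) ha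
  | @cons u v c huv _ ih =>
    have ih := ih hab ha hχ
    by_cases he : s(u, v) = s(c, b)
    · rcases Sym2.eq_iff.1 he with ⟨rfl, rfl⟩ | ⟨rfl, rfl⟩
      · exact iff_of_false (not_side_left hab) ha
      · exact iff_of_true (side_right hab) hb
    · rw [hχ u v huv he, ← ih]
      constructor
      · intro h1
        by_contra h2
        obtain ⟨rfl, rfl⟩ := eq_of_side_of_not_side hΓ hab huv.symm h1 h2
        exact he Sym2.eq_swap
      · intro h1
        by_contra h2
        obtain ⟨rfl, rfl⟩ := eq_of_side_of_not_side hΓ hab huv h1 h2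
        exact he rfl

variable {G : Type*} [Group G]

theorem exists_equivariant {X W : Type*} [MulAction G X] [MulAction G W] (s : Set X)
    (hs : ∀ x ∈ s, ∀ g : G, g • x ∈ s)
    (hfix : ∀ x ∈ s, ∃ w : W, ∀ g : G, g • x = x → g • w = w) (hW : Nonempty W) :
    ∃ F : X → W, ∀ x ∈ s, ∀ g : G, F (g • x) = g • F x := by
  classical
  have hrep : ∃ rep : X → X, (∀ x, ∃ g : G, g • rep x = x) ∧ ∀ x (g : G), rep (g • x) = rep x := by
    refine ⟨fun x => (Quotient.mk (MulAction.orbitRel G X) x).out, fun x => ?_, fun x g => ?_⟩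
    · have h : MulAction.orbitRel G X (Quotient.mk (MulAction.orbitRel G X) x).out x :=
        Quotient.mk_out (s := MulAction.orbitRel G X) x
      exact MulAction.orbitRel_apply.1 ((MulAction.orbitRel G X).symm h)
    · have : Quotient.mk (MulAction.orbitRel G X) (g • x) = Quotient.mk (MulAction.orbitRel G X) x :=
        Quotient.sound (MulAction.orbitRel_apply.2 ⟨g, rfl⟩)
      simp only [this]
  obtain ⟨rep, h1, h2⟩ := hrep
  choose γ hγ using h1
  choose! w hw using hfix
  refine ⟨fun x => γ x • w (rep x), fun x hx g => ?_⟩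
  have hrs : rep x ∈ s := by
    have := hs x hx (γ x)⁻¹
    rwa [inv_smul_eq_iff.2 (hγ x).symm] at this
  have h3 : ((γ x)⁻¹ * g⁻¹ * γ (g • x)) • rep x = rep x := by
    have h4 := hγ (g • x)
    rw [h2] at h4
    rw [mul_smul, h4, mul_smul, inv_smul_smul, inv_smul_eq_iff, hγ]
  have h4 := hw _ hrs _ h3
  simp only [h2]
  rw [mul_smul, mul_smul, inv_smul_eq_iff, inv_smul_eq_iff] at h4
  exact h4

variable {V W : Type*} [MulAction G V] [MulAction G W] {Γ : SimpleGraph V} {Δ : SimpleGraph W}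

/-- Equivariant attaching points in `Δ` for the edges of `Γ`. -/
structure IsAttaching (G : Type*) [Group G] {V W : Type*} [MulAction G V] [MulAction G W]
    (Γ : SimpleGraph V) (m : V → V → W) : Prop where
  symm : ∀ a b, m a b = m b a
  smul : ∀ (g : G) (a b), Γ.Adj a b → m (g • a) (g • b) = g • m a b

theorem exists_isAttaching (hΓ : IsTreeAction G Γ) (hΔ : IsTreeAction G Δ)
    (hell : ∀ a b, Γ.Adj a b → ∃ w : W, ∀ g : G, g • a = a → g • b = b → g • w = w) :
    ∃ m : V → V → W, IsAttaching G Γ m := by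
  have hpair : ∀ (g : G) (a b : V), g • ({a, b} : Set V) = {g • a, g • b} := fun g a b =>
    Set.image_pair (g • ·) a b
  obtain ⟨F, hF⟩ := exists_equivariant (G := G) (W := W) {s : Set V | ∃ a b, Γ.Adj a b ∧ s = {a, b}}
    (by
      rintro _ ⟨a, b, hab, rfl⟩ g
      exact ⟨g • a, g • b, hΓ.adj_smul g a b hab, hpair g a b⟩)
    (by
      rintro _ ⟨a, b, hab, rfl⟩
      obtain ⟨w, hw⟩ := hell a b hab
      refine ⟨w, fun g hg => ?_⟩
      rw [hpair, Set.pair_eq_pair_iff] at hg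
      rcases hg with hg | hg
      · exact hw g hg.1 hg.2
      · exact absurd hg (hΓ.noInversion g a b hab))
    hΔ.isTree.connected.nonempty
  refine ⟨fun a b => F {a, b}, fun a b => by rw [Set.pair_comm], fun g a b hab => ?_⟩
  rw [← hpair, hF _ ⟨a, b, hab, rfl⟩]

/-- The tree obtained from `Γ` by blowing up each vertex to a copy of `Δ`, the edge `ab` being
attached at `m a b`. -/
def Refine (Γ : SimpleGraph V) (Δ : SimpleGraph W) (m : V → V → W) (hm : ∀ a b, m a b = m b a) :
    SimpleGraph (V × W) where
  Adj x y := (x.1 = y.1 ∧ Δ.Adj x.2 y.2) ∨ (Γ.Adj x.1 y.1 ∧ x.2 = y.2 ∧ x.2 = m x.1 y.1)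
  symm := by
    constructor
    rintro x y (⟨h1, h2⟩ | ⟨h1, h2, h3⟩)
    · exact Or.inl ⟨h1.symm, h2.symm⟩
    · exact Or.inr ⟨h1.symm, h2.symm, by rw [← h2, h3, hm]⟩
  loopless := by
    constructor
    rintro x (⟨_, h⟩ | ⟨h, _⟩)
    · exact Δ.irrefl h
    · exact Γ.irrefl h

variable {m : V → V → W} {hm : ∀ a b, m a b = m b a}

theorem refine_connected (hΓ : Γ.IsTree) (hΔ : Δ.IsTree) : (Refine Γ Δ m hm).Connected := by
  have hv : ∀ v w w', (Refine Γ Δ m hm).Reachable (v, w) (v, w') := by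
    intro v w w'
    obtain ⟨p⟩ := hΔ.connected.preconnected w w'
    induction p with
    | nil => exact SimpleGraph.Reachable.refl _
    | cons h _ ih =>
      refine SimpleGraph.Reachable.trans (SimpleGraph.Adj.reachable ?_) ih
      exact Or.inl ⟨rfl, h⟩
  have hall : ∀ v v', ∀ w w', (Refine Γ Δ m hm).Reachable (v, w) (v', w') := by
    intro v v'
    obtain ⟨p⟩ := hΓ.connected.preconnected v v'
    induction p with
    | nil => exact hv _
    | @cons a b c h _ ih =>
      intro w w'
      refine (hv a w (m a b)).trans (SimpleGraph.Reachable.trans (SimpleGraph.Adj.reachable ?_)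
        (ih (m a b) w'))
      exact Or.inr ⟨h, rfl, rfl⟩
  have := hΓ.connected.nonempty
  have := hΔ.connected.nonempty
  exact SimpleGraph.Connected.mk fun x y => hall x.1 y.1 x.2 y.2

theorem refine_cut_vertical (hΓ : Γ.IsTree) {v v' : V} (h : Γ.Adj v v') (x y : V × W)
    (hxy : (Refine Γ Δ m hm).Adj x y) (hne : s(x, y) ≠ s((v, m v v'), (v', m v v'))) :
    Side Γ v v' x.1 ↔ Side Γ v v' y.1 := by
  rcases hxy with ⟨h1, -⟩ | ⟨h1, h2, h3⟩
  · rw [h1]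
  · obtain ⟨x1, x2⟩ := x
    obtain ⟨y1, y2⟩ := y
    simp only at h1 h2 h3 ⊢
    subst h2
    constructor
    · intro hx
      by_contra hy
      obtain ⟨rfl, rfl⟩ := eq_of_side_of_not_side hΓ h h1.symm hx hy
      apply hne
      rw [h3, hm, Sym2.eq_swap]
    · intro hy
      by_contra hx
      obtain ⟨rfl, rfl⟩ := eq_of_side_of_not_side hΓ h h1 hy hx
      apply hne
      rw [h3]

theorem refine_cut_horizontal (hΓ : Γ.IsTree) (hΔ : Δ.IsTree) (v : V) {w w' : W} (h : Δ.Adj w w') :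
    ∃ χ : V × W → Prop, ¬ χ (v, w) ∧ χ (v, w') ∧ ∀ x y, (Refine Γ Δ m hm).Adj x y →
      s(x, y) ≠ s((v, w), (v, w')) → (χ x ↔ χ y) := by
  have hno : ∀ r, ¬ (Γ.Adj v r ∧ Side Γ v r v) := fun r h' => not_side_left h'.1 h'.2
  let χ : V × W → Prop := fun x => (x.1 = v ∧ Side Δ w w' x.2) ∨
    ∃ r, Γ.Adj v r ∧ Side Γ v r x.1 ∧ Side Δ w w' (m v r)
  have hχv : ∀ z, χ (v, z) ↔ Side Δ w w' z := by
    intro z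
    simp only [χ, true_and]
    refine or_iff_left ?_
    rintro ⟨r, h1, h2, -⟩
    exact hno r ⟨h1, h2⟩
  have hχn : ∀ u z, u ≠ v → (χ (u, z) ↔ ∃ r, Γ.Adj v r ∧ Side Γ v r u ∧ Side Δ w w' (m v r)) := by
    intro u z hu
    simp only [χ, hu, false_and, false_or]
  have hχa : ∀ u, Γ.Adj v u → (χ (u, m v u) ↔ Side Δ w w' (m v u)) := by
    intro u hu
    rw [hχn u _ hu.ne']
    constructor
    · rintro ⟨r, h1, h2, h3⟩
      rwa [next_unique hΓ hu h1 (side_right hu) h2]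
    · intro h1
      exact ⟨u, hu, side_right hu, h1⟩
  refine ⟨χ, ?_, ?_, ?_⟩
  · rw [hχv]; exact not_side_left h
  · rw [hχv]; exact side_right h
  · rintro ⟨x1, x2⟩ ⟨y1, y2⟩ hxy hne
    rcases hxy with ⟨h1, h2⟩ | ⟨h1, h2, h3⟩
    · simp only at h1 h2
      subst h1
      by_cases hx : x1 = v
      · subst hx
        rw [hχv, hχv]
        constructor
        · intro h3
          by_contra h4
          obtain ⟨rfl, rfl⟩ := eq_of_side_of_not_side hΔ h h2.symm h3 h4
          exact hne Sym2.eq_swap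
        · intro h3
          by_contra h4
          obtain ⟨rfl, rfl⟩ := eq_of_side_of_not_side hΔ h h2 h3 h4
          exact hne rfl
      · rw [hχn _ _ hx, hχn _ _ hx]
    · simp only at h1 h2 h3
      subst h2
      by_cases hx : x1 = v
      · subst hx
        rw [hχv, h3, hχa y1 h1]
      by_cases hy : y1 = v
      · subst hy
        rw [hχv, h3, hm, hχa x1 h1.symm]
      rw [hχn _ _ hx, hχn _ _ hy]
      refine exists_congr fun r => and_congr_right fun hr => and_congr_left fun _ => ?_
      constructor
      · intro h4
        by_contra h5
        exact hy (eq_of_side_of_not_side hΓ hr h1.symm h4 h5).1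
      · intro h4
        by_contra h5
        exact hx (eq_of_side_of_not_side hΓ hr h1 h4 h5).1

theorem refine_isTree (hΓ : Γ.IsTree) (hΔ : Δ.IsTree) : (Refine Γ Δ m hm).IsTree := by
  refine ⟨refine_connected hΓ hΔ, isAcyclic_of_forall_cut ?_⟩
  rintro ⟨a1, a2⟩ ⟨b1, b2⟩ (⟨h1, h2⟩ | ⟨h1, h2, h3⟩)
  · simp only at h1 h2
    subst h1
    obtain ⟨χ, h3, h4, h5⟩ := refine_cut_horizontal (m := m) (hm := hm) hΓ hΔ a1 h2
    exact ⟨χ, fun h => h3 (h.2 h4), h5⟩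
  · simp only at h1 h2 h3
    subst h2
    subst h3
    exact ⟨fun x => Side Γ a1 b1 x.1, fun h => not_side_left h1 (h.2 (side_right h1)),
      refine_cut_vertical hΓ h1⟩

theorem refine_isTreeAction (hΓ : IsTreeAction G Γ) (hΔ : IsTreeAction G Δ)
    (hatt : IsAttaching G Γ m) : IsTreeAction G (Refine Γ Δ m hatt.symm) where
  isTree := refine_isTree hΓ.isTree hΔ.isTree
  adj_smul := by
    rintro g a b (⟨h1, h2⟩ | ⟨h1, h2, h3⟩)
    · exact Or.inl ⟨congrArg (g • ·) h1, hΔ.adj_smul g _ _ h2⟩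
    · exact Or.inr ⟨hΓ.adj_smul g _ _ h1, congrArg (g • ·) h2,
        (congrArg (g • ·) h3).trans (hatt.smul g _ _ h1).symm⟩
  noInversion := by
    rintro g a b (⟨h1, h2⟩ | ⟨h1, h2, h3⟩) ⟨h4, h5⟩
    · exact hΔ.noInversion g _ _ h2 ⟨congrArg Prod.snd h4, congrArg Prod.snd h5⟩
    · exact hΓ.noInversion g _ _ h1 ⟨congrArg Prod.fst h4, congrArg Prod.fst h5⟩

theorem walls_subset_refine {D : Set G} (hΓ : IsTreeAction G Γ) (hΔ : IsTreeAction G Δ)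
    (hatt : IsAttaching G Γ m) (v₀ : V) (w₀ : W) :
    Walls D Γ v₀ ⊆ Walls D (Refine Γ Δ m hatt.symm) (v₀, w₀) := by
  rintro Z ⟨p, q, hpq, hZ⟩
  have hadj : (Refine Γ Δ m hatt.symm).Adj (p, m p q) (q, m p q) := Or.inr ⟨hpq, rfl, rfl⟩
  refine ⟨_, _, hadj, ?_⟩
  convert hZ using 1
  ext g
  rw [mem_half, mem_half, side_iff_of_cut (refine_isTree hΓ.isTree hΔ.isTree) hadj
    (χ := fun x => Side Γ p q x.1) (not_side_left hpq) (side_right hpq)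
    (refine_cut_vertical hΓ.isTree hpq)]
  rfl

end Refinement

section FiniteGeneration

variable {G : Type*} [Group G]

/-- The stabilizer of a class of an equivalence relation generated by a cofinite, locally finite
relation is finitely generated. -/
theorem fg_of_eqvGen {α : Type*} [MulAction G α] {r : α → α → Prop}
    (hr : ∀ (g : G) a b, r a b → r (g • a) (g • b)) {P : Set α}
    (hrP : ∀ a b, r a b → a ∈ P ∧ b ∈ P) (hP : ∀ (g : G), ∀ a ∈ P, g • a ∈ P)
    {π : α → G} (hπ : ∀ g a, π (g • a) = g * π a) (hfin : {a | a ∈ P ∧ π a = 1}.Finite)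
    {D : Set G} (hD : D.Finite) (hrD : ∀ a b, r a b → (π a)⁻¹ * π b ∈ D) {c : α}
    {H : Subgroup G} (hH : ∀ g, g ∈ H ↔ Relation.EqvGen r c (g • c)) : H.FG := by
  classical
  have hsmul : ∀ (g : G) a b, Relation.EqvGen r a b → Relation.EqvGen r (g • a) (g • b) := by
    intro g a b h
    induction h with
    | rel a b h => exact .rel _ _ (hr g a b h)
    | refl => exact .refl _
    | symm _ _ _ ih => exact ih.symm
    | trans _ _ _ _ _ ih1 ih2 => exact ih1.trans _ _ _ ih2
  let τ : α → α := fun a => (π a)⁻¹ • a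
  let F : Set α := {a | a ∈ P ∧ π a = 1}
  have hτF : ∀ a, a ∈ P → τ a ∈ F := fun a ha => ⟨hP _ a ha, by simp [τ, hπ]⟩
  have hτs : ∀ (g : G) a, τ (g • a) = τ a := by
    intro g a
    simp only [τ, hπ, mul_inv_rev, mul_smul, inv_smul_smul]
  obtain ⟨γ, hγ⟩ : ∃ γ : α → G, ∀ a, Relation.EqvGen r c a →
      Relation.EqvGen r c (γ (τ a) • τ a) := by
    have : ∀ f, ∃ g : G, ∀ a, Relation.EqvGen r c a → τ a = f → Relation.EqvGen r c (g • f) := by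
      intro f
      by_cases hf : ∃ a, Relation.EqvGen r c a ∧ τ a = f
      · obtain ⟨a, ha, rfl⟩ := hf
        exact ⟨π a, fun _ _ _ => by simpa [τ] using ha⟩
      · exact ⟨1, fun a ha hf' => absurd ⟨a, ha, hf'⟩ hf⟩
    choose γ hγ using this
    exact ⟨γ, fun a ha => hγ _ a ha rfl⟩
  let h : α → G := fun a => π a * (γ (τ a))⁻¹
  have hhs : ∀ (g : G) a, h (g • a) = g * h a := by
    intro g a
    simp only [h, hτs, hπ, mul_assoc]
  have hhH : ∀ a, Relation.EqvGen r c a → h a ∈ H := by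
    intro a ha
    rw [hH]
    have h1 := hsmul (h a) _ _ (hγ a ha)
    have h2 : h a • γ (τ a) • τ a = a := by simp [h, τ, mul_smul]
    rw [h2] at h1
    exact ha.trans _ _ _ h1.symm
  let S : Set G := (fun t : (α × α) × G => γ t.1.1 * t.2 * (γ t.1.2)⁻¹) '' ((F ×ˢ F) ×ˢ D)
  have hS : S.Finite := ((hfin.prod hfin).prod hD).image _
  let S' : Set G := insert (h c) (S ∩ H)
  have hS' : S'.Finite := (hS.inter_of_left _).insert _
  have hrS : ∀ a b, r a b → (h a)⁻¹ * h b ∈ S := by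
    intro a b hab
    refine ⟨((τ a, τ b), (π a)⁻¹ * π b), ⟨⟨hτF a (hrP a b hab).1, hτF b (hrP a b hab).2⟩,
      hrD a b hab⟩, ?_⟩
    simp [h, mul_assoc]
  have hcl : ∀ a b, Relation.EqvGen r a b → Relation.EqvGen r c a →
      (h a)⁻¹ * h b ∈ Subgroup.closure S' := by
    intro a b hab
    induction hab with
    | rel a b hab =>
      intro ha
      refine Subgroup.subset_closure (Or.inr ⟨hrS a b hab, ?_⟩)
      exact H.mul_mem (H.inv_mem (hhH a ha)) (hhH b (ha.trans _ _ _ (.rel _ _ hab)))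
    | refl a => intro _; simp
    | symm a b hab ih =>
      intro hb
      have := inv_mem (ih (hb.trans _ _ _ hab.symm))
      simpa using this
    | trans a b d hab _ ih1 ih2 =>
      intro ha
      have := mul_mem (ih1 ha) (ih2 (ha.trans _ _ _ hab))
      simpa [mul_assoc] using this
  refine (Subgroup.fg_iff H).2 ⟨S', le_antisymm ?_ ?_, hS'⟩
  · rw [Subgroup.closure_le]
    rintro x (rfl | hx)
    · exact hhH c (.refl _)
    · exact hx.2
  · intro g hg
    have h1 := hcl c _ ((hH g).1 hg) (.refl _)
    rw [hhs] at h1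
    have h2 : h c ∈ Subgroup.closure S' := Subgroup.subset_closure (Or.inl rfl)
    have h3 := mul_mem (mul_mem h2 h1) (inv_mem h2)
    simpa [mul_assoc] using h3

end FiniteGeneration

section MinimalSubtree

variable {G : Type u} [Group G] {V : Type u} [MulAction G V] {Γ : SimpleGraph V}

theorem IsTreeAction.exists_minimal_subtree (h : IsTreeAction G Γ) {F : Set V} (hF : F.Finite)
    (hcof : ∀ v : V, ∃ g : G, g • v ∈ F) :
    ∃ X : Set V, X.Nonempty ∧ (∀ g : G, ∀ v ∈ X, g • v ∈ X) ∧ (Γ.induce X).Connected ∧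
      ∀ X' : Set V, X' ⊆ X → X'.Nonempty → (∀ g : G, ∀ v ∈ X', g • v ∈ X') →
        (Γ.induce X').Connected → X' = X := by
  classical
  let Q : Set V → Prop := fun X => X.Nonempty ∧ (∀ g : G, ∀ v ∈ X, g • v ∈ X) ∧
    (Γ.induce X).Connected
  have hex : ∃ n, ∃ X, Q X ∧ (X ∩ F).ncard = n := by
    have := h.isTree.connected.nonempty
    refine ⟨_, Set.univ, ⟨Set.univ_nonempty, fun _ _ _ => trivial, ?_⟩, rfl⟩
    exact h.isTree.connected.map (H := Γ.induce Set.univ) ⟨fun v => ⟨v, trivial⟩, fun h => h⟩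
      fun v => ⟨v.1, rfl⟩
  obtain ⟨X, hX, hn⟩ := Nat.find_spec hex
  refine ⟨X, hX.1, hX.2.1, hX.2.2, fun X' hsub h1 h2 h3 => Set.Subset.antisymm hsub ?_⟩
  have h4 := Nat.find_min' hex ⟨X', ⟨h1, h2, h3⟩, rfl⟩
  rw [← hn] at h4
  have h5 : X' ∩ F = X ∩ F := Set.eq_of_subset_of_ncard_le
    (Set.inter_subset_inter_left _ hsub) h4 (hF.inter_of_right _)
  intro v hv
  obtain ⟨g, hg⟩ := hcof v
  have h6 : g • v ∈ X' ∩ F := by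
    rw [h5]
    exact ⟨hX.2.1 g v hv, hg⟩
  simpa using h2 g⁻¹ _ h6.1

theorem IsTreeAction.exists_gtree (h : IsTreeAction G Γ) {F : Set V} (hF : F.Finite)
    (hcof : ∀ v : V, ∃ g : G, g • v ∈ F) :
    ∃ (T : GTree G) (ι : T.V → V), Function.Injective ι ∧
      (∀ a b, T.graph.Adj a b → Γ.Adj (ι a) (ι b)) ∧ ∀ g a, ι (T.act g a) = g • ι a := by
  obtain ⟨X, hne, hinv, hconn, hmin⟩ := h.exists_minimal_subtree hF hcof
  refine ⟨{ V := X
            graph := Γ.induce X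
            nonempty := hne.to_subtype
            connected := hconn
            acyclic := h.isTree.isAcyclic.induce X
            act := fun g v => ⟨g • v.1, hinv g v.1 v.2⟩
            act_one := fun v => Subtype.ext (one_smul G v.1)
            act_mul := fun g k v => Subtype.ext (mul_smul g k v.1)
            act_adj := fun g a b hab => h.adj_smul g _ _ hab
            noInversion := fun g a b hab h' =>
              h.noInversion g _ _ hab ⟨congrArg Subtype.val h'.1, congrArg Subtype.val h'.2⟩
            minimal := ?_ }, Subtype.val, Subtype.val_injective, fun _ _ hab => hab,
          fun _ _ => rfl⟩
  intro S hS hSinv hSconn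
  have h1 := hmin (Subtype.val '' S) (Subtype.coe_image_subset X S) (hS.image _) (by
    rintro g _ ⟨v, hv, rfl⟩
    exact ⟨_, hSinv g v hv, rfl⟩) (by
    refine hSconn.map (H := Γ.induce (Subtype.val '' S))
      ⟨fun v => ⟨v.1.1, v.1, v.2, rfl⟩, fun h => h⟩ ?_
    rintro ⟨_, v, hv, rfl⟩
    exact ⟨⟨v, hv⟩, rfl⟩)
  ext v
  simp only [Set.mem_univ, iff_true]
  have h2 : v.1 ∈ Subtype.val '' S := by rw [h1]; exact v.2
  obtain ⟨w, hw, he⟩ := h2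
  rwa [← Subtype.ext he]

end MinimalSubtree

/-! ### The resolution of a tree action -/

section Resolution

variable {G : Type*} [Group G] {V : Type*} [MulAction G V]

/-- A point of the resolution: an edge `(x, y)` of the Cayley graph together with a vertex `p` of
the geodesic from `x • v₀` to `y • v₀`. -/
@[ext]
structure Pt (D : Set G) (Γ : SimpleGraph V) (v₀ : V) where
  x : G
  y : G
  p : V
  nbr : Nbr D x y
  btw : Btw Γ (x • v₀) p (y • v₀)

variable {D : Set G} {Γ : SimpleGraph V} {v₀ : V}

instance [h : IsTreeAction G Γ] : MulAction G (Pt D Γ v₀) where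
  smul g s := ⟨g * s.x, g * s.y, g • s.p, s.nbr.smul g, by
    rw [mul_smul, mul_smul, h.btw_smul]; exact s.btw⟩
  one_smul s := Pt.ext (one_mul _) (one_mul _) (one_smul _ _)
  mul_smul g k s := Pt.ext (mul_assoc _ _ _) (mul_assoc _ _ _) (mul_smul _ _ _)

/-- Points joined by a leaf of a triangle, or by exchanging the orientation of an edge. -/
def Glue (D : Set G) (Γ : SimpleGraph V) (v₀ : V) (s t : Pt D Γ v₀) : Prop :=
  s.p = t.p ∧ ((s.x = t.x ∧ Nbr D s.y t.y) ∨ (s.x = t.y ∧ s.y = t.x))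

/-- The vertices of the resolution. -/
def Res (D : Set G) (Γ : SimpleGraph V) (v₀ : V) := Quot (Glue D Γ v₀)

theorem Glue.smul [IsTreeAction G Γ] (g : G) {s t : Pt D Γ v₀} (h : Glue D Γ v₀ s t) :
    Glue D Γ v₀ (g • s) (g • t) := by
  refine ⟨congrArg (g • ·) h.1, ?_⟩
  rcases h.2 with h | h
  · exact Or.inl ⟨congrArg (g * ·) h.1, h.2.smul g⟩
  · exact Or.inr ⟨congrArg (g * ·) h.1, congrArg (g * ·) h.2⟩

instance [IsTreeAction G Γ] : MulAction G (Res D Γ v₀) where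
  smul g := Quot.map (g • ·) fun _ _ h => h.smul g
  one_smul := by
    rintro ⟨s⟩
    exact congrArg (Quot.mk _) (one_smul G s)
  mul_smul g k := by
    rintro ⟨s⟩
    exact congrArg (Quot.mk _) (mul_smul g k s)

/-- The class of a point of the resolution. -/
def Pt.cls (s : Pt D Γ v₀) : Res D Γ v₀ := Quot.mk _ s

theorem Pt.smul_cls [IsTreeAction G Γ] (g : G) (s : Pt D Γ v₀) : g • s.cls = (g • s).cls := rfl

/-- The projection of the resolution to the original tree. -/
def Res.proj : Res D Γ v₀ → V := Quot.lift Pt.p fun _ _ h => h.1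

theorem Res.proj_cls (s : Pt D Γ v₀) : s.cls.proj = s.p := rfl

theorem Res.proj_smul [IsTreeAction G Γ] (g : G) (A : Res D Γ v₀) :
    (g • A).proj = g • A.proj := by
  obtain ⟨s⟩ := A
  rfl

/-- The resolution of a tree. -/
def resGraph (D : Set G) (Γ : SimpleGraph V) (v₀ : V) : SimpleGraph (Res D Γ v₀) where
  Adj A B := ∃ s t : Pt D Γ v₀, s.x = t.x ∧ s.y = t.y ∧ Γ.Adj s.p t.p ∧ s.cls = A ∧ t.cls = B
  symm := by
    constructor
    rintro _ _ ⟨s, t, h1, h2, h3, rfl, rfl⟩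
    exact ⟨t, s, h1.symm, h2.symm, h3.symm, rfl, rfl⟩
  loopless := by
    constructor
    rintro A ⟨s, t, h1, h2, h3, h4, h5⟩
    have : s.p = t.p := by rw [← Res.proj_cls, ← Res.proj_cls, h4, h5]
    exact h3.ne this

theorem resGraph_adj_proj {A B : Res D Γ v₀} (h : (resGraph D Γ v₀).Adj A B) :
    Γ.Adj A.proj B.proj := by
  obtain ⟨s, t, h1, h2, h3, rfl, rfl⟩ := h
  exact h3

/-- The same point for the opposite orientation. -/
def Pt.swap (hD : IsAcyclicGen D) (s : Pt D Γ v₀) : Pt D Γ v₀ :=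
  ⟨s.y, s.x, s.p, s.nbr.symm hD, s.btw.symm⟩

theorem Pt.cls_swap (hD : IsAcyclicGen D) (s : Pt D Γ v₀) : (s.swap hD).cls = s.cls :=
  Quot.sound ⟨rfl, Or.inr ⟨rfl, rfl⟩⟩

theorem resGraph_connected (hD : IsAcyclicGen D) (hΓ : Γ.IsTree) :
    (resGraph D Γ v₀).Connected := by
  let base : G → Pt D Γ v₀ := fun x => ⟨x, x, x • v₀, Nbr.refl hD x, btw_left _ _⟩
  have hend : ∀ s : Pt D Γ v₀, s.p = s.y • v₀ → s.cls = (base s.y).cls := by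
    intro s hs
    rw [← s.cls_swap hD]
    exact Quot.sound ⟨hs, Or.inl ⟨rfl, s.nbr⟩⟩
  have hstart : ∀ s : Pt D Γ v₀, s.p = s.x • v₀ → s.cls = (base s.x).cls := fun s hs =>
    Quot.sound ⟨hs, Or.inl ⟨rfl, s.nbr.symm hD⟩⟩
  have hslide : ∀ n, ∀ s : Pt D Γ v₀, Γ.dist s.p (s.y • v₀) ≤ n →
      (resGraph D Γ v₀).Reachable s.cls (base s.y).cls := by
    intro n
    induction n with
    | zero =>
      intro s hs
      rw [hend s (hΓ.connected.dist_eq_zero_iff.1 (by omega))]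
    | succ n ih =>
      intro s hs
      by_cases he : s.p = s.y • v₀
      · rw [hend s he]
      · obtain ⟨r, hr, hside⟩ := exists_next hΓ he
        have h1 := (side_iff hΓ hr _).1 hside
        have hbtw := s.btw
        rw [SimpleGraph.dist_comm, SimpleGraph.dist_comm (v := r)] at h1
        have h2 : Btw Γ (s.x • v₀) r (s.y • v₀) := by
          have h3 := hΓ.connected.dist_triangle (u := s.x • v₀) (v := s.p) (w := r)
          have h4 := hΓ.connected.dist_triangle (u := s.x • v₀) (v := r) (w := s.y • v₀)
          rw [SimpleGraph.dist_eq_one_iff_adj.2 hr] at h3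
          rw [Btw] at hbtw ⊢
          omega
        let t : Pt D Γ v₀ := ⟨s.x, s.y, r, s.nbr, h2⟩
        refine SimpleGraph.Reachable.trans (SimpleGraph.Adj.reachable ?_)
          (ih t (by change Γ.dist r (s.y • v₀) ≤ n; omega))
        exact ⟨s, t, rfl, rfl, hr, rfl, rfl⟩
  have hbase : ∀ x, (resGraph D Γ v₀).Reachable (base 1).cls (base x).cls := by
    refine nbr_induction hD 1 (SimpleGraph.Reachable.refl _) ?_
    intro x y hxy ih
    refine ih.trans ?_
    let s : Pt D Γ v₀ := ⟨x, y, x • v₀, hxy, btw_left _ _⟩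
    have := hslide _ s le_rfl
    rwa [hstart s rfl] at this
  refine (SimpleGraph.connected_iff_exists_forall_reachable _).2 ⟨(base 1).cls, ?_⟩
  rintro ⟨s⟩
  exact (hbase s.y).trans (hslide _ s le_rfl).symm

/-- The side of the point `s` with respect to the wall `Z` of the half-space `(p, q)`. -/
def Pt.above (Z : Set G) (p q : V) (s : Pt D Γ v₀) : Prop :=
  (s.x ∈ Z ∧ s.y ∈ Z) ∨ (¬ (s.x ∈ Z ↔ s.y ∈ Z) ∧ Side Γ p q s.p)

theorem above_iff_of_glue (hD : IsAcyclicGen D) (hΓ : Γ.IsTree) {Z : Set G} {p q : V}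
    (hpq : Γ.Adj p q) (hZ : IsWall D (Half G Γ v₀ p q) Z) {s t : Pt D Γ v₀}
    (h : Glue D Γ v₀ s t) : s.above Z p q ↔ t.above Z p q := by
  have hin : ∀ s : Pt D Γ v₀, ∀ z, s.x ∈ Z → s.y ∈ Z → z ∉ Z → Nbr D z s.x → Nbr D z s.y →
      Side Γ p q s.p := by
    intro s z hx hy hz hzx hzy
    have h1 : (z, s.x) ∈ Cob D Z := ⟨hzx, hz, hx⟩
    have h2 : (z, s.y) ∈ Cob D Z := ⟨hzy, hz, hy⟩
    exact s.btw.side hΓ hpq (hZ.cob_subset h1).2.2 (hZ.cob_subset h2).2.2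
  have hout : ∀ s : Pt D Γ v₀, ∀ z, s.x ∉ Z → s.y ∉ Z → z ∈ Z → Nbr D s.x z → Nbr D s.y z →
      ¬ Side Γ p q s.p := by
    intro s z hx hy hz hzx hzy
    have h1 : (s.x, z) ∈ Cob D Z := ⟨hzx, hx, hz⟩
    have h2 : (s.y, z) ∈ Cob D Z := ⟨hzy, hy, hz⟩
    exact s.btw.not_side hΓ hpq (hZ.cob_subset h1).2.1 (hZ.cob_subset h2).2.1
  obtain ⟨hp, ⟨hx, hyy⟩ | ⟨hx, hy⟩⟩ := h
  · have hxy := s.nbr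
    have hxz := t.nbr
    have i1 := hin s t.y
    have i2 := hin t s.y
    have o1 := hout s t.y
    have o2 := hout t s.y
    rw [← hx] at hxz i2 o2
    rw [← hp] at i2 o2
    simp only [hxy, hxz, hyy, hxy.symm hD, hxz.symm hD, hyy.symm hD, forall_true_left] at i1 i2 o1 o2
    simp only [Pt.above, ← hx, ← hp]
    clear hin hout
    by_cases a : s.x ∈ Z <;> by_cases b : s.y ∈ Z <;> by_cases c : t.y ∈ Z <;> simp_all
  · simp only [Pt.above, hp, hx, hy]
    tauto

/-- The side of a vertex of the resolution with respect to a wall. -/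
def Res.Above (Z : Set G) (p q : V) (A : Res D Γ v₀) : Prop := ∃ s : Pt D Γ v₀, s.cls = A ∧ s.above Z p q

theorem above_cls (hD : IsAcyclicGen D) (hΓ : Γ.IsTree) {Z : Set G} {p q : V}
    (hpq : Γ.Adj p q) (hZ : IsWall D (Half G Γ v₀ p q) Z) (s : Pt D Γ v₀) :
    s.cls.Above Z p q ↔ s.above Z p q := by
  constructor
  · rintro ⟨t, ht, hab⟩
    have := Quot.eqvGen_exact ht
    have key : ∀ a b : Pt D Γ v₀, Relation.EqvGen (Glue D Γ v₀) a b →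
        (a.above Z p q ↔ b.above Z p q) := by
      intro a b h
      induction h with
      | rel a b h => exact above_iff_of_glue hD hΓ hpq hZ h
      | refl => exact Iff.rfl
      | symm _ _ _ ih => exact ih.symm
      | trans _ _ _ _ _ ih1 ih2 => exact ih1.trans ih2
    exact (key _ _ this).1 hab
  · exact fun h => ⟨s, rfl, h⟩

/-- The point over `p` of an edge entering the half-space `(p, q)`. -/
def ptLeft (hΓ : Γ.IsTree) {p q : V} (hpq : Γ.Adj p q) {c : G × G}
    (hc : c ∈ Cob D (Half G Γ v₀ p q)) : Pt D Γ v₀ :=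
  ⟨c.1, c.2, p, hc.1, (btw_of_sep hΓ hpq hc.2.1 hc.2.2).1⟩

/-- The point over `q` of an edge entering the half-space `(p, q)`. -/
def ptRight (hΓ : Γ.IsTree) {p q : V} (hpq : Γ.Adj p q) {c : G × G}
    (hc : c ∈ Cob D (Half G Γ v₀ p q)) : Pt D Γ v₀ :=
  ⟨c.1, c.2, q, hc.1, (btw_of_sep hΓ hpq hc.2.1 hc.2.2).2⟩

theorem cls_eq_of_step (hD : IsAcyclicGen D) {s t : Pt D Γ v₀} (hp : s.p = t.p)
    (h : (s.x = t.x ∧ Nbr D s.y t.y) ∨ (s.y = t.y ∧ Nbr D s.x t.x)) : s.cls = t.cls := by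
  rcases h with h | h
  · exact Quot.sound ⟨hp, Or.inl h⟩
  · rw [← s.cls_swap hD, ← t.cls_swap hD]
    exact Quot.sound ⟨hp, Or.inl h⟩

theorem cls_eq_of_mem_track (hD : IsAcyclicGen D) (hΓ : Γ.IsTree) {p q : V} (hpq : Γ.Adj p q)
    {c c' : G × G} (hc : c ∈ Cob D (Half G Γ v₀ p q)) (hc' : c' ∈ Cob D (Half G Γ v₀ p q))
    (h : c' ∈ Track D (Half G Γ v₀ p q) c) :
    (ptLeft hΓ hpq hc').cls = (ptLeft hΓ hpq hc).cls ∧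
      (ptRight hΓ hpq hc').cls = (ptRight hΓ hpq hc).cls := by
  change Relation.ReflTransGen _ _ _ at h
  induction h with
  | refl => exact ⟨rfl, rfl⟩
  | @tail a b h1 h2 ih =>
    obtain ⟨ih1, ih2⟩ := ih h2.1
    rw [← ih1, ← ih2]
    exact ⟨(cls_eq_of_step (s := ptLeft hΓ hpq h2.1) (t := ptLeft hΓ hpq hc') hD rfl h2.2.2).symm,
      (cls_eq_of_step (s := ptRight hΓ hpq h2.1) (t := ptRight hΓ hpq hc') hD rfl h2.2.2).symm⟩

theorem resGraph_adj_iff (hD : IsAcyclicGen D) (hΓ : Γ.IsTree) {A B : Res D Γ v₀} :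
    (resGraph D Γ v₀).Adj A B ↔ ∃ (p q : V) (hpq : Γ.Adj p q) (c : G × G)
      (hc : c ∈ Cob D (Half G Γ v₀ p q)), (ptLeft hΓ hpq hc).cls = A ∧ (ptRight hΓ hpq hc).cls = B := by
  constructor
  · rintro ⟨s, ⟨x, y, q, h0, htb⟩, rfl, rfl, hpq, rfl, rfl⟩
    have hsb := s.btw
    change Γ.Adj s.p q at hpq
    by_cases hx : Side Γ s.p q (s.x • v₀)
    · have hy : ¬ Side Γ s.p q (s.y • v₀) := fun hy =>
        not_side_left hpq (hsb.side hΓ hpq hx hy)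
      refine ⟨s.p, q, hpq, (s.y, s.x), ⟨s.nbr.symm hD, hy, hx⟩, ?_, ?_⟩
      · exact Pt.cls_swap hD s
      · exact Pt.cls_swap hD ⟨s.x, s.y, q, h0, htb⟩
    · have hy : Side Γ s.p q (s.y • v₀) := by
        by_contra hy
        exact htb.not_side hΓ hpq hx hy (side_right hpq)
      exact ⟨s.p, q, hpq, (s.x, s.y), ⟨s.nbr, hx, hy⟩, rfl, rfl⟩
  · rintro ⟨p, q, hpq, c, hc, rfl, rfl⟩
    exact ⟨ptLeft hΓ hpq hc, ptRight hΓ hpq hc, rfl, rfl, hpq, rfl, rfl⟩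

theorem not_above_ptLeft {p q : V} (hΓ : Γ.IsTree) (hpq : Γ.Adj p q) {Z : Set G}
    {c : G × G} (hc : c ∈ Cob D (Half G Γ v₀ p q)) (hcZ : c ∈ Cob D Z) :
    ¬ (ptLeft hΓ hpq hc).above Z p q := by
  rintro (h | h)
  · exact hcZ.2.1 h.1
  · exact not_side_left hpq h.2

theorem above_ptRight {p q : V} (hΓ : Γ.IsTree) (hpq : Γ.Adj p q) {Z : Set G}
    {c : G × G} (hc : c ∈ Cob D (Half G Γ v₀ p q)) (hcZ : c ∈ Cob D Z) :
    (ptRight hΓ hpq hc).above Z p q :=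
  Or.inr ⟨fun h => hcZ.2.1 (h.2 hcZ.2.2), side_right hpq⟩

theorem resGraph_isTree (hD : IsAcyclicGen D) (hΓ : Γ.IsTree) : (resGraph D Γ v₀).IsTree := by
  refine ⟨resGraph_connected hD hΓ, isAcyclic_of_forall_cut ?_⟩
  intro A B hAB
  obtain ⟨p, q, hpq, c, hc, rfl, rfl⟩ := (resGraph_adj_iff hD hΓ).1 hAB
  obtain ⟨Z, hZ, hcZ⟩ := exists_wall hD hc
  refine ⟨Res.Above Z p q, ?_, ?_⟩
  · rw [above_cls hD hΓ hpq hZ, above_cls hD hΓ hpq hZ]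
    exact fun h => not_above_ptLeft hΓ hpq hc hcZ (h.2 (above_ptRight hΓ hpq hc hcZ))
  · intro A' B' h' hne
    obtain ⟨p', q', hpq', c', hc', rfl, rfl⟩ := (resGraph_adj_iff hD hΓ).1 h'
    rw [above_cls hD hΓ hpq hZ, above_cls hD hΓ hpq hZ]
    refine or_congr Iff.rfl (and_congr_right fun hsep => ?_)
    change ¬ (c'.1 ∈ Z ↔ c'.2 ∈ Z) at hsep
    change Side Γ p q p' ↔ Side Γ p q q'
    have htr := hZ.cob_eq hD hcZ
    have hcase : c' ∈ Cob D Z ∨ c'.swap ∈ Cob D Z := by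
      have h1 := hc'.1
      by_cases h2 : c'.1 ∈ Z
      · exact Or.inr ⟨h1.symm hD, fun h3 => hsep (iff_of_true h2 h3), h2⟩
      · exact Or.inl ⟨h1, h2, by by_contra h3; exact hsep (iff_of_false h2 h3)⟩
    have main : ∀ (s t : Pt D Γ v₀), s.x = t.x → s.y = t.y → (s.x, s.y) ∈ Cob D Z →
        s.p = p → t.p = q → s.cls = (ptLeft hΓ hpq hc).cls ∧ t.cls = (ptRight hΓ hpq hc).cls := by
      rintro ⟨x, y, p, hs1, hs2⟩ ⟨x', y', q, ht1, ht2⟩ rfl rfl hcob rfl rfl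
      have hcob' := hZ.cob_subset hcob
      rw [htr] at hcob
      exact cls_eq_of_mem_track hD hΓ hpq hc hcob' hcob
    have main' : ∀ (s t : Pt D Γ v₀), s.x = t.x → s.y = t.y →
        ((s.x, s.y) ∈ Cob D Z ∨ (s.y, s.x) ∈ Cob D Z) →
        s.p = p → t.p = q → s.cls = (ptLeft hΓ hpq hc).cls ∧ t.cls = (ptRight hΓ hpq hc).cls := by
      rintro s t hx hy (h | h) hp hq
      · exact main s t hx hy h hp hq
      · rw [← s.cls_swap hD, ← t.cls_swap hD]
        exact main (s.swap hD) (t.swap hD) hy hx h hp hq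
    constructor
    · intro h1
      by_contra h2
      obtain ⟨rfl, rfl⟩ := eq_of_side_of_not_side hΓ hpq hpq'.symm h1 h2
      obtain ⟨e1, e2⟩ := main' (ptRight hΓ hpq' hc') (ptLeft hΓ hpq' hc') rfl rfl hcase rfl rfl
      exact hne (by rw [e1, e2, Sym2.eq_swap])
    · intro h1
      by_contra h2
      obtain ⟨rfl, rfl⟩ := eq_of_side_of_not_side hΓ hpq hpq' h1 h2
      obtain ⟨e1, e2⟩ := main' (ptLeft hΓ hpq' hc') (ptRight hΓ hpq' hc') rfl rfl hcase rfl rfl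
      exact hne (by rw [e1, e2])

theorem resGraph_isTreeAction [h : IsTreeAction G Γ] (hD : IsAcyclicGen D) :
    IsTreeAction G (resGraph D Γ v₀) where
  isTree := resGraph_isTree hD h.isTree
  adj_smul := by
    rintro g _ _ ⟨s, t, h1, h2, h3, rfl, rfl⟩
    exact ⟨g • s, g • t, congrArg (g * ·) h1, congrArg (g * ·) h2, h.adj_smul g _ _ h3, rfl, rfl⟩
  noInversion := by
    rintro g A B hAB ⟨h1, h2⟩
    refine h.noInversion g _ _ (resGraph_adj_proj hAB) ⟨?_, ?_⟩
    · rw [← Res.proj_smul, h1]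
    · rw [← Res.proj_smul, h2]

end Resolution

/-! ### Stabilizers in the resolution -/

section ResolutionStabilizers

variable {G : Type*} [Group G] {V : Type*} [MulAction G V] {D : Set G} {Γ : SimpleGraph V} {v₀ : V}

theorem finite_pts (hD : IsAcyclicGen D) (hΓ : Γ.IsTree) :
    {s : Pt D Γ v₀ | s.x = 1}.Finite := by
  refine Set.Finite.of_finite_image (f := fun s => (s.y, s.p))
    ((hD.finite.biUnion (t := fun y => (fun p => (y, p)) '' {r | Btw Γ v₀ r (y • v₀)})
      fun y _ => (btw_finite hΓ _ _).image _).subset ?_) ?_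
  · rintro _ ⟨s, hs, rfl⟩
    have hs : s.x = 1 := hs
    have h1 := s.nbr
    have h2 := s.btw
    rw [hs, Nbr, inv_one, one_mul] at h1
    rw [hs, one_smul] at h2
    exact Set.mem_biUnion h1 ⟨s.p, h2, rfl⟩
  · intro s hs t ht hst
    exact Pt.ext (hs.trans ht.symm) (congrArg Prod.fst hst) (congrArg Prod.snd hst)

theorem res_cofinite (hD : IsAcyclicGen D) [h : IsTreeAction G Γ] :
    ∃ F : Set (Res D Γ v₀), F.Finite ∧ ∀ A, ∃ g : G, g • A ∈ F := by
  refine ⟨_, (finite_pts hD h.isTree).image Pt.cls, ?_⟩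
  rintro ⟨s⟩
  exact ⟨s.x⁻¹, s.x⁻¹ • s, inv_mul_cancel s.x, rfl⟩

theorem res_stabilizer_fg (hD : IsAcyclicGen D) [h : IsTreeAction G Γ] (A : Res D Γ v₀)
    {H : Subgroup G} (hH : ∀ g, g ∈ H ↔ g • A = A) : H.FG := by
  obtain ⟨s⟩ := A
  refine fg_of_eqvGen (r := Glue D Γ v₀) (P := Set.univ) (π := Pt.x) (D := D) (c := s)
    (fun g a b hab => hab.smul g) (fun _ _ _ => ⟨trivial, trivial⟩) (fun _ _ _ => trivial)
    (fun _ _ => rfl) ((finite_pts hD h.isTree).subset fun a ha => ha.2) hD.finite ?_ ?_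
  · rintro a b ⟨-, ⟨h1, -⟩ | ⟨-, h2⟩⟩
    · rw [h1, inv_mul_cancel]
      exact hD.one_mem
    · rw [← h2]
      exact a.nbr
  · intro g
    rw [hH]
    exact ⟨fun h1 => Quot.eqvGen_exact h1.symm, fun h1 => (Quot.eqvGen_sound h1).symm⟩

/-- The edges of the resolution represented by the edge `a.1` of the Cayley graph and the edge
`a.2` of the tree. -/
def resEdges (D : Set G) (Γ : SimpleGraph V) (v₀ : V) (a : (G × G) × (V × V)) :
    Set (Res D Γ v₀ × Res D Γ v₀) :=
  {e | ∃ s t : Pt D Γ v₀, (s.x, s.y) = a.1 ∧ (t.x, t.y) = a.1 ∧ (s.p, t.p) = a.2 ∧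
    e = (s.cls, t.cls)}

theorem resEdges_subsingleton (a : (G × G) × (V × V)) : (resEdges D Γ v₀ a).Subsingleton := by
  rintro _ ⟨s, t, h1, h2, h3, rfl⟩ _ ⟨s', t', h1', h2', h3', rfl⟩
  have e1 := h1.trans h1'.symm
  have e2 := h2.trans h2'.symm
  have e3 := h3.trans h3'.symm
  rw [Pt.ext (congrArg Prod.fst e1) (congrArg Prod.snd e1) (congrArg Prod.fst e3),
    Pt.ext (congrArg Prod.fst e2) (congrArg Prod.snd e2) (congrArg Prod.snd e3)]

/-- Consecutive edges of a track of a half-space. -/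
def EdgeStep (D : Set G) (Γ : SimpleGraph V) (v₀ : V) (a b : (G × G) × (V × V)) : Prop :=
  a.2 = b.2 ∧ Γ.Adj a.2.1 a.2.2 ∧ Step D (Half G Γ v₀ a.2.1 a.2.2) a.1 b.1

theorem EdgeStep.symm (hD : IsAcyclicGen D) {a b : (G × G) × (V × V)} (h : EdgeStep D Γ v₀ a b) :
    EdgeStep D Γ v₀ b a := by
  obtain ⟨h1, h2, h3⟩ := h
  exact ⟨h1.symm, h1 ▸ h2, h1 ▸ h3.symm hD⟩

theorem EdgeStep.resEdges_subset (hD : IsAcyclicGen D) (hΓ : Γ.IsTree) {a b : (G × G) × (V × V)}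
    (h : EdgeStep D Γ v₀ a b) : resEdges D Γ v₀ a ⊆ resEdges D Γ v₀ b := by
  obtain ⟨c, p, q⟩ := a
  obtain ⟨c', p', q'⟩ := b
  obtain ⟨h1, h2, -, h3, h4⟩ := h
  simp only [Prod.mk.injEq] at h1 h2 h3 h4
  obtain ⟨rfl, rfl⟩ := h1
  rintro _ ⟨s, t, rfl, e2, e3, rfl⟩
  simp only [Prod.mk.injEq] at e2 e3
  obtain ⟨rfl, rfl⟩ := e3
  refine ⟨ptLeft hΓ h2 h3, ptRight hΓ h2 h3, rfl, rfl, rfl, ?_⟩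
  rw [cls_eq_of_step (s := s) (t := ptLeft hΓ h2 h3) hD rfl h4,
    cls_eq_of_step (s := t) (t := ptRight hΓ h2 h3) hD rfl (by rw [e2.1, e2.2]; exact h4)]

theorem resEdges_eq_of_eqvGen (hD : IsAcyclicGen D) (hΓ : Γ.IsTree) {a b : (G × G) × (V × V)}
    (h : Relation.EqvGen (EdgeStep D Γ v₀) a b) : resEdges D Γ v₀ a = resEdges D Γ v₀ b := by
  induction h with
  | rel a b h =>
    exact (h.resEdges_subset hD hΓ).antisymm ((h.symm hD).resEdges_subset hD hΓ)
  | refl => rfl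
  | symm _ _ _ ih => exact ih.symm
  | trans _ _ _ _ _ ih1 ih2 => exact ih1.trans ih2

theorem eqvGen_of_mem_track {p q : V} (hpq : Γ.Adj p q) {c c' : G × G}
    (h : c' ∈ Track D (Half G Γ v₀ p q) c) :
    Relation.EqvGen (EdgeStep D Γ v₀) (c, p, q) (c', p, q) := by
  change Relation.ReflTransGen _ _ _ at h
  induction h with
  | refl => exact .refl _
  | tail _ h ih => exact ih.trans _ _ _ (.rel _ _ ⟨rfl, hpq, h⟩)

theorem mem_track_of_fixed (hD : IsAcyclicGen D) [h : IsTreeAction G Γ] {p q : V}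
    (hpq : Γ.Adj p q) {c : G × G} (hc : c ∈ Cob D (Half G Γ v₀ p q)) {g : G}
    (hA : g • (ptLeft h.isTree hpq hc).cls = (ptLeft h.isTree hpq hc).cls)
    (hB : g • (ptRight h.isTree hpq hc).cls = (ptRight h.isTree hpq hc).cls) :
    g • p = p ∧ g • q = q ∧ g • c ∈ Track D (Half G Γ v₀ p q) c := by
  have hp : g • p = p := by
    have := congrArg Res.proj hA
    rwa [Res.proj_smul] at this
  have hq : g • q = q := by
    have := congrArg Res.proj hB
    rwa [Res.proj_smul] at this
  refine ⟨hp, hq, ?_⟩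
  obtain ⟨Z, hZ, hcZ⟩ := exists_wall hD hc
  have h1 := not_above_ptLeft h.isTree hpq hc hcZ
  have h2 := above_ptRight h.isTree hpq hc hcZ
  rw [← above_cls hD h.isTree hpq hZ, ← hA, Pt.smul_cls, above_cls hD h.isTree hpq hZ] at h1
  rw [← above_cls hD h.isTree hpq hZ, ← hB, Pt.smul_cls, above_cls hD h.isTree hpq hZ] at h2
  have hgc := smul_mem_cob g hc
  rw [← h.half_smul, hp, hq] at hgc
  have hsep : ¬ (g * c.1 ∈ Z ↔ g * c.2 ∈ Z) := by
    intro he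
    rcases h2 with h2 | h2
    · exact h1 (Or.inl h2)
    · exact h2.1 he
  rw [← hZ.cob_eq hD hcZ]
  refine ⟨hgc.1, ?_⟩
  by_cases hx : g * c.1 ∈ Z
  · have hy : g * c.2 ∉ Z := fun hy => hsep (iff_of_true hx hy)
    have : (g * c.2, g * c.1) ∈ Cob D Z := ⟨hgc.1.symm hD, hy, hx⟩
    exact absurd hgc.2.2 (hZ.cob_subset this).2.1
  · exact ⟨hx, by by_contra hy; exact hsep (iff_of_false hx hy)⟩

theorem res_edge_stabilizer_fg (hD : IsAcyclicGen D) [h : IsTreeAction G Γ] {A B : Res D Γ v₀}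
    (hAB : (resGraph D Γ v₀).Adj A B) {H : Subgroup G}
    (hH : ∀ g, g ∈ H ↔ g • A = A ∧ g • B = B) : H.FG := by
  obtain ⟨p, q, hpq, c, hc, rfl, rfl⟩ := (resGraph_adj_iff hD h.isTree).1 hAB
  refine fg_of_eqvGen (r := EdgeStep D Γ v₀)
    (P := {a | Γ.Adj a.2.1 a.2.2 ∧ a.1 ∈ Cob D (Half G Γ v₀ a.2.1 a.2.2)})
    (π := fun a => a.1.1) (D := D) (c := (c, p, q)) ?_ ?_ ?_ (fun _ _ => rfl) ?_ hD.finite ?_ ?_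
  · rintro g ⟨⟨x, y⟩, p, q⟩ ⟨⟨x', y'⟩, p', q'⟩ ⟨h1, h2, h3, h4, h5⟩
    obtain ⟨rfl, rfl⟩ := Prod.mk.inj h1
    refine ⟨rfl, h.adj_smul g _ _ h2, ?_⟩
    change Step D (Half G Γ v₀ (g • p) (g • q)) (g * x, g * y) (g * x', g * y')
    rw [h.half_smul]
    refine ⟨smul_mem_cob g h3, smul_mem_cob g h4, ?_⟩
    rcases h5 with h5 | h5
    · exact Or.inl ⟨congrArg (g * ·) h5.1, h5.2.smul g⟩
    · exact Or.inr ⟨congrArg (g * ·) h5.1, h5.2.smul g⟩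
  · rintro ⟨c, p, q⟩ ⟨c', p', q'⟩ ⟨h1, h2, h3, h4, -⟩
    obtain ⟨rfl, rfl⟩ := Prod.mk.inj h1
    exact ⟨⟨h2, h3⟩, h2, h4⟩
  · rintro g ⟨⟨x, y⟩, p, q⟩ ⟨h1, h2⟩
    refine ⟨h.adj_smul g _ _ h1, ?_⟩
    change (g * x, g * y) ∈ Cob D (Half G Γ v₀ (g • p) (g • q))
    rw [h.half_smul]
    exact smul_mem_cob g h2
  · refine (hD.finite.biUnion
      (t := fun y => (fun e => (((1 : G), y), e)) '' Sep Γ ((1 : G) • v₀) (y • v₀))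
      fun y _ => (sep_finite h.isTree _ _).image _).subset ?_
    rintro ⟨⟨x, y⟩, p, q⟩ ⟨⟨h1, h2⟩, h3⟩
    obtain rfl : x = 1 := h3
    have h4 : (1 : G)⁻¹ * y ∈ D := h2.1
    rw [inv_one, one_mul] at h4
    exact Set.mem_biUnion h4 ⟨(p, q), mem_sep_of_cob h1 h2, rfl⟩
  · rintro ⟨⟨x, y⟩, p, q⟩ ⟨⟨x', y'⟩, p', q'⟩ ⟨-, -, -, -, h5⟩
    rcases h5 with h5 | h5
    · change x = x' ∧ _ at h5
      change x⁻¹ * x' ∈ D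
      rw [h5.1, inv_mul_cancel]
      exact hD.one_mem
    · exact h5.2
  · intro g
    rw [hH]
    constructor
    · rintro ⟨hA, hB⟩
      obtain ⟨hp, hq, htr⟩ := mem_track_of_fixed hD hpq hc hA hB
      have := eqvGen_of_mem_track hpq htr
      have hgc : g • (c, p, q) = (g • c, p, q) := Prod.ext rfl (Prod.ext hp hq)
      rwa [hgc]
    · intro he
      have heq := resEdges_eq_of_eqvGen hD h.isTree he
      have h1 : ((ptLeft h.isTree hpq hc).cls, (ptRight h.isTree hpq hc).cls) ∈
          resEdges D Γ v₀ (c, p, q) := ⟨_, _, rfl, rfl, rfl, rfl⟩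
      have h2 : (g • (ptLeft h.isTree hpq hc).cls, g • (ptRight h.isTree hpq hc).cls) ∈
          resEdges D Γ v₀ (g • (c, p, q)) :=
        ⟨g • ptLeft h.isTree hpq hc, g • ptRight h.isTree hpq hc, rfl, rfl, rfl, rfl⟩
      rw [← heq] at h2
      exact Prod.mk.inj (resEdges_subsingleton _ h2 h1)

end ResolutionStabilizers

/-! ### Domination -/

section Domination

theorem eq_or_swap_mem_cob {G : Type*} [Group G] {D : Set G} (hD : IsAcyclicGen D) {Z : Set G}
    {x y : G} (hxy : Nbr D x y) (h : ¬ (x ∈ Z ↔ y ∈ Z)) : (x, y) ∈ Cob D Z ∨ (y, x) ∈ Cob D Z := by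
  by_cases hx : x ∈ Z
  · exact Or.inr ⟨hxy.symm hD, fun hy => h (iff_of_true hx hy), hx⟩
  · exact Or.inl ⟨hxy, hx, by by_contra hy; exact h (iff_of_false hx hy)⟩

variable {G : Type*} [Group G] {V : Type*} [MulAction G V] {D : Set G} {Γ : SimpleGraph V} {v₀ : V}

/-- If every wall of `Δ` is a wall of `Γ`, then the vertex stabilizers of the resolution of `Γ` are
elliptic in `Δ`. -/
theorem exists_fixed_of_walls_subset (hD : IsAcyclicGen D) [h : IsTreeAction G Γ] {W : Type*}
    [MulAction G W] {Δ : SimpleGraph W} (hΔ : IsTreeAction G Δ) {w₀ : W}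
    (hwalls : Walls D Δ w₀ ⊆ Walls D Γ v₀) {H : Subgroup G} {A : Res D Γ v₀}
    (hA : ∀ g ∈ H, g • A = A) : ∃ w : W, ∀ g ∈ H, g • w = w := by
  obtain ⟨s⟩ := A
  let K : Set (Set G) := {Z | Z ∈ Walls D Γ v₀ ∧ ((s.x, s.y) ∈ Cob D Z ∨ (s.y, s.x) ∈ Cob D Z)}
  have hK : K.Finite := by
    refine ((finite_walls_of_mem_cob hD h.isTree v₀ (s.x, s.y)).union
      (finite_walls_of_mem_cob hD h.isTree v₀ (s.y, s.x))).subset ?_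
    rintro Z ⟨h1, h2 | h2⟩
    · exact Or.inl ⟨h1, h2⟩
    · exact Or.inr ⟨h1, h2⟩
  have hKmem : ∀ Z ∈ Walls D Γ v₀, ¬ (s.x ∈ Z ↔ s.y ∈ Z) → Z ∈ K := fun Z hZ h1 =>
    ⟨hZ, eq_or_swap_mem_cob hD s.nbr h1⟩
  have hcross : ∀ g ∈ H, ∀ Z ∈ Walls D Γ v₀, ¬ (s.x ∈ Z ↔ g * s.x ∈ Z) → Z ∈ K ∨ g⁻¹ • Z ∈ K := by
    intro g hg Z hZ hsep
    by_contra hne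
    rw [not_or] at hne
    have h1 : s.x ∈ Z ↔ s.y ∈ Z := by
      by_contra h1
      exact hne.1 (hKmem Z hZ h1)
    have h2 : g * s.x ∈ Z ↔ g * s.y ∈ Z := by
      by_contra h2
      refine hne.2 (hKmem _ (h.smul_mem_walls _ hZ) ?_)
      rwa [Set.mem_smul_set_iff_inv_smul_mem, Set.mem_smul_set_iff_inv_smul_mem, inv_inv]
    obtain ⟨p, q, hpq, hw⟩ := hZ
    have hab : s.above Z p q ↔ (g • s).above Z p q := by
      rw [← above_cls hD h.isTree hpq hw, ← above_cls hD h.isTree hpq hw, ← Pt.smul_cls]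
      exact iff_of_eq (congrArg _ (hA g hg).symm)
    have e1 : s.above Z p q ↔ s.x ∈ Z := by
      simp only [Pt.above, ← h1]
      tauto
    have e2 : (g • s).above Z p q ↔ g * s.x ∈ Z := by
      change ((g * s.x ∈ Z ∧ g * s.y ∈ Z) ∨ (¬ (g * s.x ∈ Z ↔ g * s.y ∈ Z) ∧ _)) ↔ _
      rw [← h2]
      tauto
    exact hsep (e1.symm.trans (hab.trans e2))
  let L : Set (W × W) := ⋃ Z ∈ K, {e | Δ.Adj e.1 e.2 ∧ IsWall D (Half G Δ w₀ e.1 e.2) Z}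
  have hL : L.Finite := hK.biUnion fun Z _ => finite_edges_of_wall hΔ.isTree w₀ Z
  refine hΔ.exists_fixed_of_bounded H (s.x • w₀) (L.ncard + L.ncard) fun g hg => ?_
  refine (dist_le_ncard_sep hΔ.isTree _ _).trans ?_
  have hsub : Sep Δ (s.x • w₀) (g • s.x • w₀) ⊆ L ∪ (g • ·) '' L := by
    rintro ⟨p, q⟩ ⟨hpq, h1, h2⟩
    rw [smul_smul] at h2
    obtain ⟨Z, hZ, hsep⟩ := exists_separating_wall hD (Y := Half G Δ w₀ p q) (x := s.x)
      (w := g * s.x) fun h3 => h1 (h3.2 h2)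
    rcases hcross g hg Z (hwalls ⟨p, q, hpq, hZ⟩) hsep with h4 | h4
    · exact Or.inl (Set.mem_biUnion h4 ⟨hpq, hZ⟩)
    · refine Or.inr ⟨g⁻¹ • (p, q), Set.mem_biUnion h4 ⟨hΔ.adj_smul _ _ _ hpq, ?_⟩,
        smul_inv_smul g (p, q)⟩
      change IsWall D (Half G Δ w₀ (g⁻¹ • p) (g⁻¹ • q)) _
      rw [hΔ.half_smul]
      exact hZ.smul _
  calc (Sep Δ (s.x • w₀) (g • s.x • w₀)).ncard ≤ (L ∪ (g • ·) '' L).ncard :=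
        Set.ncard_le_ncard hsub (hL.union (hL.image _))
    _ ≤ L.ncard + ((g • ·) '' L).ncard := Set.ncard_union_le _ _
    _ ≤ L.ncard + L.ncard := Nat.add_le_add_left (Set.ncard_image_le hL) _

end Domination

/-! ### Trees maximizing the number of orbits of walls -/

section Maximal

variable {G : Type u} [Group G]

/-- The action of `G` on the vertices of a `G`-tree. -/
abbrev gtreeAction (T : GTree G) : MulAction G T.V where
  smul := T.act
  one_smul := T.act_one
  mul_smul := T.act_mul

theorem gtree_isTreeAction (T : GTree G) : @IsTreeAction G _ T.V (gtreeAction T) T.graph :=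
  let _ := gtreeAction T
  { isTree := ⟨T.connected, T.acyclic⟩
    adj_smul := T.act_adj
    noInversion := T.noInversion }

/-- Every edge stabilizer is contained in a universally elliptic member of `𝒜`. -/
def Admissible (𝒜 : Set (Subgroup G)) {V : Type*} [MulAction G V] (Γ : SimpleGraph V) : Prop :=
  ∀ a b, Γ.Adj a b → ∃ H ∈ 𝒜, GTree.UnivEllipticSubgroup 𝒜 H ∧
    ∀ g : G, g • a = a → g • b = b → g ∈ H

/-- The numbers of orbits of walls of the admissible trees. -/
def wallCounts (D : Set G) (𝒜 : Set (Subgroup G)) : Set ℕ :=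
  {n | ∃ (V : Type u) (_ : MulAction G V) (Γ : SimpleGraph V) (v₀ : V),
    IsTreeAction G Γ ∧ Admissible 𝒜 Γ ∧ (WallOrbits D Γ v₀).ncard = n}

theorem wallCounts_nonempty (D : Set G) (𝒜 : Set (Subgroup G)) : (wallCounts D 𝒜).Nonempty := by
  let act : MulAction G PUnit.{u + 1} :=
    { smul := fun _ x => x
      one_smul := fun _ => rfl
      mul_smul := fun _ _ _ => rfl }
  refine ⟨_, PUnit.{u + 1}, act, ⊥, PUnit.unit, ⟨⟨?_, SimpleGraph.isAcyclic_bot⟩, ?_, ?_⟩, ?_, rfl⟩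
  · exact SimpleGraph.connected_iff_exists_forall_reachable _ |>.2
      ⟨PUnit.unit, fun _ => SimpleGraph.Reachable.refl _⟩
  · exact fun _ _ _ h => h.elim
  · exact fun _ _ _ h => h.elim
  · exact fun _ _ h => h.elim

theorem exists_maximal_tree {D : Set G} (hD : IsAcyclicGen D) (𝒜 : Set (Subgroup G)) :
    ∃ (V : Type u) (_ : MulAction G V) (Γ : SimpleGraph V) (v₀ : V),
      IsTreeAction G Γ ∧ Admissible 𝒜 Γ ∧
      ∀ n ∈ wallCounts D 𝒜, n ≤ (WallOrbits D Γ v₀).ncard := by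
  have hbdd : BddAbove (wallCounts D 𝒜) := by
    refine ⟨(D ×ˢ D).ncard, ?_⟩
    rintro _ ⟨V, _, Γ, v₀, h, -, rfl⟩
    exact (h.wallOrbits_bound hD v₀).2
  obtain ⟨V, act, Γ, v₀, h1, h2, h3⟩ := Nat.sSup_mem (wallCounts_nonempty D 𝒜) hbdd
  exact ⟨V, act, Γ, v₀, h1, h2, fun n hn => h3 ▸ le_csSup hbdd hn⟩

theorem univElliptic_mono {𝒜 : Set (Subgroup G)} {H K : Subgroup G}
    (hH : GTree.UnivEllipticSubgroup 𝒜 H) (hKH : K ≤ H) : GTree.UnivEllipticSubgroup 𝒜 K := by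
  intro T hT
  obtain ⟨w, hw⟩ := hH T hT
  exact ⟨w, fun g hg => hw g (hKH hg)⟩

theorem Admissible.refine {𝒜 : Set (Subgroup G)} {V W : Type*} [MulAction G V] [MulAction G W]
    {Γ : SimpleGraph V} {Δ : SimpleGraph W} (hΓ : Admissible 𝒜 Γ) (hΔ : Admissible 𝒜 Δ)
    {m : V → V → W} (hm : ∀ a b, m a b = m b a) : Admissible 𝒜 (Refine Γ Δ m hm) := by
  rintro a b (⟨-, h⟩ | ⟨h, -⟩)
  · obtain ⟨H, h1, h2, h3⟩ := hΔ _ _ h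
    exact ⟨H, h1, h2, fun g ha hb => h3 g (congrArg Prod.snd ha) (congrArg Prod.snd hb)⟩
  · obtain ⟨H, h1, h2, h3⟩ := hΓ _ _ h
    exact ⟨H, h1, h2, fun g ha hb => h3 g (congrArg Prod.fst ha) (congrArg Prod.fst hb)⟩

theorem walls_eq_of_ncard_le {D : Set G} (hD : IsAcyclicGen D) {V W : Type*} [MulAction G V]
    [MulAction G W] {Γ : SimpleGraph V} {Δ : SimpleGraph W} {v₀ : V} {w₀ : W}
    (hΓ : IsTreeAction G Γ) (hΔ : IsTreeAction G Δ) (hsub : Walls D Γ v₀ ⊆ Walls D Δ w₀)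
    (hle : (WallOrbits D Δ w₀).ncard ≤ (WallOrbits D Γ v₀).ncard) :
    Walls D Δ w₀ ⊆ Walls D Γ v₀ := by
  have horb : WallOrbits D Γ v₀ = WallOrbits D Δ w₀ :=
    Set.eq_of_subset_of_ncard_le (Set.image_mono hsub) hle (hΔ.wallOrbits_bound hD w₀).1
  intro Z hZ
  have h1 : MulAction.orbit G Z ∈ WallOrbits D Γ v₀ := horb ▸ ⟨Z, hZ, rfl⟩
  obtain ⟨Z', hZ', h2⟩ := h1
  have h3 : Z ∈ MulAction.orbit G Z' := by
    have := MulAction.mem_orbit_self (M := G) Z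
    rwa [← h2] at this
  obtain ⟨g, rfl⟩ := h3
  exact hΓ.smul_mem_walls g hZ'

theorem exists_fixed_of_maximal {D : Set G} (hD : IsAcyclicGen D) {𝒜 : Set (Subgroup G)}
    {V : Type u} [MulAction G V] {Γ : SimpleGraph V} {v₀ : V} [hΓ : IsTreeAction G Γ]
    (hadm : Admissible 𝒜 Γ) (hmax : ∀ n ∈ wallCounts D 𝒜, n ≤ (WallOrbits D Γ v₀).ncard)
    {T : GTree G} (hT : T.IsATree 𝒜) (hTu : T.UnivEllipticTree 𝒜) {H : Subgroup G}
    {A : Res D Γ v₀} (hA : ∀ g ∈ H, g • A = A) : T.EllipticSubgroup H := by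
  let _ := gtreeAction T
  have hΔ : IsTreeAction G T.graph := gtree_isTreeAction T
  have hadm' : Admissible 𝒜 T.graph := fun a b hab =>
    ⟨_, hT a b hab, hTu a b hab, fun g ha hb => ⟨ha, hb⟩⟩
  obtain ⟨m, hm⟩ := exists_isAttaching hΓ hΔ fun a b hab => by
    obtain ⟨K, -, hK, hK'⟩ := hadm a b hab
    obtain ⟨w, hw⟩ := hK T hT
    exact ⟨w, fun g ha hb => hw g (hK' g ha hb)⟩
  obtain ⟨w₀⟩ := T.nonempty
  have hR := refine_isTreeAction hΓ hΔ hm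
  have hwalls := walls_eq_of_ncard_le hD hΓ hR (walls_subset_refine (D := D) hΓ hΔ hm v₀ w₀)
    (hmax _ ⟨V × T.V, inferInstance, _, _, hR, hadm.refine hadm' hm.symm, rfl⟩)
  obtain ⟨w, hw⟩ := exists_fixed_of_walls_subset hD hR hwalls hA
  exact ⟨w.2, fun g hg => congrArg Prod.snd (hw g hg)⟩

theorem exists_jsj (hG : FinitelyPresentedGroup G) (𝒜 : Set (Subgroup G))
    (h𝒜 : ClosedFamily 𝒜) :
    ∃ T : GTree G, T.IsATree 𝒜 ∧ T.UnivEllipticTree 𝒜 ∧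
      (∀ T' : GTree G, T'.IsATree 𝒜 → T'.UnivEllipticTree 𝒜 → T.Dominates T') ∧
      (∀ a b : T.V, T.graph.Adj a b → (T.edgeStab a b).FG) ∧
      ∀ w : T.V, (T.vertexStab w).FG := by
  obtain ⟨D, hD⟩ := exists_isAcyclicGen hG
  obtain ⟨V, _, Γ, v₀, hΓ, hadm, hmax⟩ := exists_maximal_tree hD 𝒜
  obtain ⟨F, hF, hcof⟩ := res_cofinite (v₀ := v₀) hD (h := hΓ)
  obtain ⟨T, ι, hι, hadj, hact⟩ := (resGraph_isTreeAction (v₀ := v₀) hD).exists_gtree hF hcof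
  have hstab : ∀ g w, T.act g w = w ↔ g • ι w = ι w := fun g w => by rw [← hact, hι.eq_iff]
  have hedge : ∀ a b, T.graph.Adj a b → ∃ H ∈ 𝒜, GTree.UnivEllipticSubgroup 𝒜 H ∧
      T.edgeStab a b ≤ H := by
    intro a b hab
    obtain ⟨H, h1, h2, h3⟩ := hadm _ _ (resGraph_adj_proj (hadj a b hab))
    refine ⟨H, h1, h2, fun g hg => h3 g ?_ ?_⟩
    · rw [← Res.proj_smul, (hstab g a).1 hg.1]
    · rw [← Res.proj_smul, (hstab g b).1 hg.2]
  refine ⟨T, ?_, ?_, ?_, ?_, ?_⟩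
  · intro a b hab
    obtain ⟨H, h1, -, h2⟩ := hedge a b hab
    exact h𝒜.2 H h1 _ h2
  · intro a b hab
    obtain ⟨H, -, h1, h2⟩ := hedge a b hab
    exact univElliptic_mono h1 h2
  · rintro T' hT' hTu' H ⟨w, hw⟩
    exact exists_fixed_of_maximal hD hadm hmax hT' hTu' fun g hg => (hstab g w).1 (hw g hg)
  · exact fun a b hab => res_edge_stabilizer_fg hD (hadj a b hab) fun g =>
      and_congr (hstab g a) (hstab g b)
  · exact fun w => res_stabilizer_fg hD (ι w) fun g => hstab g w

end Maximal

end

end JSJ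

/-- If `G` is finitely presented, a JSJ tree of `G` over `𝒜` exists, and it
can be chosen with finitely generated edge and vertex stabilizers. -/
theorem jsj_existence (G : Type u) [Group G] (hfp : FinitelyPresentedGroup G)
    (𝒜 : Set (Subgroup G)) (h𝒜 : ClosedFamily 𝒜) :
    ∃ T : GTree G, T.IsATree 𝒜 ∧ T.UnivEllipticTree 𝒜 ∧
      (∀ T' : GTree G, T'.IsATree 𝒜 → T'.UnivEllipticTree 𝒜 → T.Dominates T') ∧
      (∀ a b : T.V, T.graph.Adj a b → (T.edgeStab a b).FG) ∧
      ∀ w : T.V, (T.vertexStab w).FG := by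
  exact JSJ.exists_jsj hfp 𝒜 h𝒜
end

section
/- Let T₁ and T₂ be 𝒜-trees such that every edge stabilizer of T₁ is elliptic in T₂. Then there exist an 𝒜-tree T̂₁ and a collapse map T̂₁ → T₁ such that: (1) T̂₁ dominates T₂; (2) the stabilizer of every edge of T̂₁ fixes both endpoints of some edge of T₁ or of some edge of T₂; (3) every edge stabilizer of T₂ contains the stabilizer of some edge of T̂₁; (4) a subgroup of G is elliptic in T̂₁ if and only if it is elliptic in both T₁ and T₂. -/
universe u v

namespace SimpleGraph

variable {V W : Type*}

/-- A vertex map sending edges to reachable pairs preserves reachability. -/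
theorem Reachable.map_of_adj {X : SimpleGraph V} {Y : SimpleGraph W} (φ : V → W)
    (h : ∀ a b, X.Adj a b → Y.Reachable (φ a) (φ b)) {a b : V} (hab : X.Reachable a b) :
    Y.Reachable (φ a) (φ b) := by
  obtain ⟨p⟩ := hab
  induction p with
  | nil => rfl
  | cons h' _ ih => exact (h _ _ h').trans ih

/-- An edge is a bridge if it is the only edge mapped to its image, under a map to an acyclic graph
sending edges to edges or vertices. -/
theorem IsAcyclic.isBridge_of_map {X : SimpleGraph V} {Y : SimpleGraph W} (hY : Y.IsAcyclic)
    (φ : V → W) (h : ∀ a b, X.Adj a b → φ a = φ b ∨ Y.Adj (φ a) (φ b)) {a b : V}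
    (hab : Y.Adj (φ a) (φ b))
    (huniq : ∀ c d, X.Adj c d → s(φ c, φ d) = s(φ a, φ b) → s(c, d) = s(a, b)) :
    X.IsBridge s(a, b) := by
  rw [isBridge_iff]
  intro hr
  refine isBridge_iff.1 (isAcyclic_iff_forall_adj_isBridge.1 hY hab) (hr.map_of_adj φ ?_)
  intro c d hcd
  rw [deleteEdges_adj, Set.mem_singleton_iff] at hcd
  rcases h c d hcd.1 with h' | h'
  · rw [h']
  · exact Adj.reachable (by
      rw [deleteEdges_adj, Set.mem_singleton_iff]
      exact ⟨h', fun e => hcd.2 (huniq c d hcd.1 e)⟩)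

/-- In a tree, the first step from `v` towards `w` depends only on the component of `w`
in the complement of `v`. -/
theorem IsTree.exists_first_step {X : SimpleGraph V} (hX : X.IsTree) (v : V) :
    ∃ r : V → V, (∀ w, X.Adj v w → r w = w) ∧
      ∀ w w', X.Adj w w' → w ≠ v → w' ≠ v → r w = r w' := by
  classical
  choose P hP hPu using hX.existsUnique_path v
  refine ⟨fun w => (P w).snd, fun w hw => ?_, ?_⟩
  · have := hPu w (.cons hw .nil) (by simp [hw.ne])
    simp [← this]
  · have key : ∀ w w', X.Adj w w' → w' ≠ v → w' ∈ (P w).support → (P w).snd = (P w').snd := by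
      intro w w' _ hw' hm
      rw [← hPu w' _ ((hP w).takeUntil hm), Walk.snd_takeUntil hw']
    intro w w' h hw hw'
    by_cases hm : w' ∈ (P w).support
    · exact key w w' h hw' hm
    · refine (key w' w h.symm hw ?_).symm
      rw [← hPu w' _ ((hP w).concat hm h)]
      simp [Walk.support_concat]

/-- In an acyclic graph, connected induced subgraphs have connected intersections. -/
theorem IsAcyclic.preconnected_induce_inter {X : SimpleGraph V} (hX : X.IsAcyclic) {S T : Set V}
    (hS : (X.induce S).Preconnected) (hT : (X.induce T).Preconnected) :
    (X.induce (S ∩ T)).Preconnected := by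
  classical
  have aux : ∀ {U : Set V}, (X.induce U).Preconnected → ∀ a ∈ U, ∀ b ∈ U,
      ∃ p : X.Path a b, ∀ c ∈ p.1.support, c ∈ U := by
    intro U hU a ha b hb
    obtain ⟨q⟩ := hU ⟨a, ha⟩ ⟨b, hb⟩
    refine ⟨q.toPath.map (Embedding.induce (G := X) U).toHom Subtype.val_injective, ?_⟩
    intro c hc
    have hc' : c ∈ (q.toPath.1.map (Embedding.induce (G := X) U).toHom).support := hc
    rw [Walk.support_map, List.mem_map] at hc'
    obtain ⟨d, -, rfl⟩ := hc'
    exact d.2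
  rintro ⟨a, haS, haT⟩ ⟨b, hbS, hbT⟩
  obtain ⟨p, hp⟩ := aux hS a haS b hbS
  obtain ⟨q, hq⟩ := aux hT a haT b hbT
  obtain rfl := (hX.subsingleton_path a b).elim p q
  exact ⟨p.1.induce (S ∩ T) fun c hc => ⟨hp c hc, hq c hc⟩⟩

/-- A connected set of vertices of a tree has at most one vertex closest to a given vertex. -/
theorem IsTree.eq_of_forall_dist_le {X : SimpleGraph V} (hX : X.IsTree) {Y : Set V}
    (hY : (X.induce Y).Preconnected) {y y' z : V} (hy : y ∈ Y) (hy' : y' ∈ Y)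
    (hmin : ∀ c ∈ Y, X.dist z y ≤ X.dist z c) (hle : X.dist z y' ≤ X.dist z y) : y = y' := by
  classical
  by_contra hne
  obtain ⟨P, hP⟩ := hX.connected.exists_walk_length_eq_dist z y
  obtain ⟨Q, hQ⟩ := hX.connected.exists_walk_length_eq_dist z y'
  have hend : ∀ {x : V} (R : X.Walk z x), R.length ≤ X.dist z y → ∀ c ∈ R.support, c ∈ Y → c = x := by
    intro x R hR c hc hcY
    by_contra hcx
    have h1 := Walk.length_takeUntil_lt_length hc hcx
    have h2 := dist_le (R.takeUntil c hc)
    have h3 := hmin c hcY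
    lia
  have hS : (X.induce ({c | c ∈ P.support} ∪ {c | c ∈ Q.support})).Preconnected := by
    have hz : ∀ c : ({c | c ∈ P.support} ∪ {c | c ∈ Q.support} : Set V),
        (X.induce ({c | c ∈ P.support} ∪ {c | c ∈ Q.support})).Reachable
          ⟨z, .inl P.start_mem_support⟩ c := by
      rintro ⟨c, hc | hc⟩
      · exact ⟨(P.takeUntil c hc).induce _ fun d hd =>
          .inl (P.support_takeUntil_subset_support hc hd)⟩
      · exact ⟨(Q.takeUntil c hc).induce _ fun d hd =>
          .inr (Q.support_takeUntil_subset_support hc hd)⟩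
    exact fun a b => (hz a).symm.trans (hz b)
  obtain ⟨R⟩ := hX.isAcyclic.preconnected_induce_inter hS hY
    ⟨y, .inl P.end_mem_support, hy⟩ ⟨y', .inr Q.end_mem_support, hy'⟩
  cases R with
  | nil => exact hne rfl
  | @cons _ d _ h _ =>
    rw [induce_adj] at h
    obtain ⟨d, hd | hd, hdY⟩ := d
    · exact h.ne (hend P hP.le d hd hdY).symm
    · obtain rfl := hend Q (hQ.trans_le hle) d hd hdY
      exact hX.dist_ne_of_adj z h (le_antisymm (hmin _ hy') hle)

section Action

variable {G : Type*} [Group G] [MulAction G V]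

theorem preconnected_induce_smul_of_generators {X : SimpleGraph V}
    (hX : ∀ (g : G) a b, X.Adj a b → X.Adj (g • a) (g • b)) {Y : Set V}
    (hY : ∀ (g : G), ∀ y ∈ Y, g • y ∈ Y) {S : Set G} (hS : Subgroup.closure S = ⊤)
    (x : Y) (hgen : ∀ s ∈ S, (X.induce Y).Reachable x ⟨s • x.1, hY s _ x.2⟩) (g : G) :
    (X.induce Y).Reachable x ⟨g • x.1, hY g _ x.2⟩ := by
  have htr : ∀ (g : G) (a b : Y), (X.induce Y).Reachable a b →
      (X.induce Y).Reachable ⟨g • a.1, hY g _ a.2⟩ ⟨g • b.1, hY g _ b.2⟩ := fun g a b h =>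
    h.map_of_adj (fun a : Y => (⟨g • a.1, hY g _ a.2⟩ : Y)) fun a b h' =>
      Adj.reachable (by rw [induce_adj] at h' ⊢; exact hX g _ _ h')
  have hg : g ∈ Subgroup.closure S := hS ▸ Subgroup.mem_top g
  induction hg using Subgroup.closure_induction with
  | mem s hs => exact hgen s hs
  | one => simp
  | mul a b _ _ ha hb =>
    have := ha.trans (htr a _ _ hb)
    simpa [mul_smul] using this
  | inv a _ ha =>
    have := htr a⁻¹ _ _ ha
    simpa using this.symm

/-- A finitely generated group acting on a connected graph preserves a finite union of orbits
that spans a connected subgraph. -/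
theorem Connected.exists_finset_preconnected_orbits [Group.FG G] {X : SimpleGraph V}
    (hconn : X.Connected) (hX : ∀ (g : G) a b, X.Adj a b → X.Adj (g • a) (g • b)) :
    ∃ F : Finset V, F.Nonempty ∧
      (X.induce {y | ∃ g : G, ∃ a ∈ F, g • a = y}).Preconnected := by
  classical
  obtain ⟨S, hS⟩ := Group.FG.out (G := G)
  obtain ⟨x⟩ := hconn.nonempty
  let P (y : V) : X.Walk x y := (hconn.preconnected x y).some
  let F : Finset V := insert x (S.biUnion fun s => (P (s • x)).support.toFinset)
  have hxF : x ∈ F := Finset.mem_insert_self _ _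
  have hPF : ∀ s ∈ S, ∀ c ∈ (P (s • x)).support, c ∈ F := fun s hs c hc =>
    Finset.mem_insert_of_mem (Finset.mem_biUnion.2 ⟨s, hs, List.mem_toFinset.2 hc⟩)
  refine ⟨F, ⟨x, hxF⟩, ?_⟩
  set Y : Set V := {y | ∃ g : G, ∃ a ∈ F, g • a = y}
  have hY : ∀ (g : G), ∀ y ∈ Y, g • y ∈ Y := by
    rintro g _ ⟨h, a, ha, rfl⟩
    exact ⟨g * h, a, ha, mul_smul _ _ _⟩
  have hFY : ∀ c ∈ F, c ∈ Y := fun c hc => ⟨1, c, hc, one_smul _ _⟩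
  have hxY : x ∈ Y := hFY x hxF
  have horb := preconnected_induce_smul_of_generators hX hY hS ⟨x, hxY⟩ fun s hs =>
    ⟨(P (s • x)).induce Y fun c hc => hFY c (hPF s hs c hc)⟩
  have hreach : ∀ y : Y, (X.induce Y).Reachable ⟨x, hxY⟩ y := by
    rintro ⟨_, g, a, ha, rfl⟩
    refine (horb g).trans ?_
    have hxa : (X.induce Y).Reachable ⟨x, hxY⟩ ⟨a, hFY a ha⟩ := by
      rcases Finset.mem_insert.1 ha with rfl | ha'
      · rfl
      · obtain ⟨s, hs, has⟩ := Finset.mem_biUnion.1 ha'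
        rw [List.mem_toFinset] at has
        exact ⟨((P (s • x)).takeUntil a has).induce Y fun c hc =>
          hFY c (hPF s hs c ((P (s • x)).support_takeUntil_subset_support has hc))⟩
    exact hxa.map_of_adj (fun a : Y => (⟨g • a.1, hY g _ a.2⟩ : Y)) fun a b h' =>
      Adj.reachable (by rw [induce_adj] at h' ⊢; exact hX g _ _ h')
  exact fun a b => (hreach a).symm.trans (hreach b)

/-- A finitely generated group acting on a connected graph has a minimal nonempty invariant
connected set of vertices. -/
theorem Connected.exists_minimal_invariant [Group.FG G] {X : SimpleGraph V}
    (hconn : X.Connected) (hX : ∀ (g : G) a b, X.Adj a b → X.Adj (g • a) (g • b)) :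
    ∃ Y : Set V, Y.Nonempty ∧ (∀ (g : G), ∀ y ∈ Y, g • y ∈ Y) ∧ (X.induce Y).Preconnected ∧
      ∀ S ⊆ Y, S.Nonempty → (∀ (g : G), ∀ y ∈ S, g • y ∈ S) → (X.induce S).Preconnected →
        S = Y := by
  classical
  obtain ⟨F, ⟨hne, hpre⟩, hmin⟩ := exists_minimalFor_of_wellFoundedLT
    (fun F : Finset V => F.Nonempty ∧
      (X.induce {y | ∃ g : G, ∃ a ∈ F, g • a = y}).Preconnected) Finset.card
    (hconn.exists_finset_preconnected_orbits hX)
  refine ⟨{y | ∃ g : G, ∃ a ∈ F, g • a = y}, ?_, ?_, hpre, ?_⟩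
  · obtain ⟨a, ha⟩ := hne
    exact ⟨a, 1, a, ha, one_smul _ _⟩
  · rintro g _ ⟨h, a, ha, rfl⟩
    exact ⟨g * h, a, ha, mul_smul _ _ _⟩
  · intro S hS hSne hSinv hSpre
    have horb : {y | ∃ g : G, ∃ a ∈ F.filter (· ∈ S), g • a = y} = S := by
      ext y
      constructor
      · rintro ⟨g, a, ha, rfl⟩
        exact hSinv g a (Finset.mem_filter.1 ha).2
      · intro hy
        obtain ⟨g, a, ha, rfl⟩ := hS hy
        refine ⟨g, a, Finset.mem_filter.2 ⟨ha, ?_⟩, rfl⟩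
        simpa using hSinv g⁻¹ _ hy
    have hFne : (F.filter (· ∈ S)).Nonempty := by
      obtain ⟨y, hy⟩ := hSne
      obtain ⟨g, a, ha, -⟩ := horb.symm ▸ hy
      exact ⟨a, ha⟩
    have hle := hmin ⟨hFne, horb.symm ▸ hSpre⟩ (Finset.card_le_card (Finset.filter_subset _ _))
    rw [Finset.eq_of_subset_of_card_le (Finset.filter_subset _ _) hle] at horb
    exact horb.symm

/-- A subgroup fixing a vertex of a tree fixes a vertex in every invariant connected set. -/
theorem IsTree.exists_fixed_mem {X : SimpleGraph V} (hX : X.IsTree)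
    (hadj : ∀ (g : G) a b, X.Adj a b → X.Adj (g • a) (g • b)) {Y : Set V} (hne : Y.Nonempty)
    (hinv : ∀ (g : G), ∀ y ∈ Y, g • y ∈ Y) (hY : (X.induce Y).Preconnected) {H : Subgroup G}
    {z : V} (hz : ∀ h ∈ H, h • z = z) : ∃ y ∈ Y, ∀ h ∈ H, h • y = y := by
  obtain ⟨y, hy, hmin⟩ := exists_minimalFor_of_wellFoundedLT (· ∈ Y) (X.dist z) hne
  have hmin' : ∀ c ∈ Y, X.dist z y ≤ X.dist z c := fun c hc =>
    (le_total (X.dist z y) (X.dist z c)).elim id (hmin hc)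
  refine ⟨y, hy, fun h hh => (hX.eq_of_forall_dist_le hY hy (hinv h y hy) hmin' ?_).symm⟩
  obtain ⟨P, hP⟩ := hX.connected.exists_walk_length_eq_dist z y
  have := dist_le (P.map (⟨(h • ·), fun {a b} => hadj h a b⟩ : X →g X))
  rw [Walk.length_map, hP] at this
  change X.dist (h • z) (h • y) ≤ _ at this
  rwa [hz h hh] at this

end Action

/-- The blow-up of the vertices of `X` into copies of `Y`, where the two ends of an edge `e` of
`X` are attached at the vertex `p e` of the corresponding copies. -/
def blowUp (X : SimpleGraph V) (Y : SimpleGraph W) (p : Sym2 V → W) : SimpleGraph (V × W) where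
  Adj a b := (a.1 = b.1 ∧ Y.Adj a.2 b.2) ∨
    (X.Adj a.1 b.1 ∧ a.2 = p s(a.1, b.1) ∧ b.2 = p s(a.1, b.1))
  symm := ⟨by
    rintro a b (⟨h, h'⟩ | ⟨h, h', h''⟩)
    · exact .inl ⟨h.symm, h'.symm⟩
    · exact .inr ⟨h.symm, by rw [Sym2.eq_swap]; exact ⟨h'', h'⟩⟩⟩
  loopless := ⟨by
    rintro a (⟨-, h⟩ | ⟨h, -⟩)
    · exact h.ne rfl
    · exact h.ne rfl⟩

section BlowUp

variable {X : SimpleGraph V} {Y : SimpleGraph W} {p : Sym2 V → W}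

theorem blowUp_fst {a b : V × W} (h : (blowUp X Y p).Adj a b) : a.1 = b.1 ∨ X.Adj a.1 b.1 :=
  h.imp And.left And.left

theorem blowUp_snd {a b : V × W} (h : (blowUp X Y p).Adj a b) : a.2 = b.2 ∨ Y.Adj a.2 b.2 :=
  (Or.symm h).imp (fun h => h.2.1.trans h.2.2.symm) And.right

theorem preconnected_blowUp_fiber (hY : Y.Preconnected) (v : V) :
    ((blowUp X Y p).induce (Prod.fst ⁻¹' {v})).Preconnected := by
  rintro ⟨⟨a, x⟩, rfl⟩ ⟨⟨b, y⟩, hb⟩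
  obtain rfl : b = a := hb
  exact (hY x y).map_of_adj (fun z => (⟨(b, z), rfl⟩ : (Prod.fst ⁻¹' {b} : Set (V × W))))
    fun c d h => Adj.reachable (by rw [induce_adj]; exact .inl ⟨rfl, h⟩)

theorem connected_blowUp (hX : X.Connected) (hY : Y.Connected) : (blowUp X Y p).Connected := by
  have hfib : ∀ v x y, (blowUp X Y p).Reachable (v, x) (v, y) := fun v x y =>
    (hY.preconnected x y).map_of_adj (fun z => (v, z)) fun c d h =>
      Adj.reachable (show (blowUp X Y p).Adj (v, c) (v, d) from .inl ⟨rfl, h⟩)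
  obtain ⟨x₀⟩ := hY.nonempty
  have : Nonempty V := hX.nonempty
  have : Nonempty W := ⟨x₀⟩
  refine ⟨?_⟩
  rintro ⟨v, x⟩ ⟨w, y⟩
  refine ((hfib v x x₀).trans ?_).trans (hfib w x₀ y)
  refine (hX.preconnected v w).map_of_adj (fun z => (z, x₀)) fun c d h => ?_
  exact (hfib c x₀ (p s(c, d))).trans
    ((Adj.reachable (.inr ⟨h, rfl, rfl⟩ : (blowUp X Y p).Adj (c, p s(c, d)) (d, p s(c, d)))).trans
      (hfib d _ x₀))

theorem isAcyclic_blowUp (hX : X.IsTree) (hY : Y.IsAcyclic) : (blowUp X Y p).IsAcyclic := by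
  classical
  rw [isAcyclic_iff_forall_adj_isBridge]
  rintro ⟨v, x⟩ ⟨w, y⟩ (⟨h, h'⟩ | ⟨h, hx, hy⟩)
  · obtain rfl : v = w := h
    obtain ⟨r, hr, hr'⟩ := hX.exists_first_step v
    let φ : V × W → W := fun a => if a.1 = v then a.2 else p s(v, r a.1)
    have hφ : ∀ c d, (blowUp X Y p).Adj c d →
        φ c = φ d ∨ (Y.Adj (φ c) (φ d) ∧ c.1 = v ∧ d.1 = v) := by
      rintro ⟨c, x⟩ ⟨d, y⟩ (⟨h, h'⟩ | ⟨h, hx, hy⟩)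
      · obtain rfl : c = d := h
        by_cases hc : c = v
        · right; simpa [φ, hc] using h'
        · left; simp [φ, hc]
      · left
        dsimp only at h hx hy
        by_cases hc : c = v
        · subst hc
          simp [φ, h.ne', hr d h, hx]
        · by_cases hd : d = v
          · subst hd
            simp [φ, hc, hr c h.symm, hy, Sym2.eq_swap]
          · simp [φ, hc, hd, hr' c d h hc hd]
    refine hY.isBridge_of_map φ (fun c d h => (hφ c d h).imp_right And.left)
      (by simpa [φ] using h') ?_
    rintro ⟨c, z⟩ ⟨d, t⟩ hcd he
    rcases hφ _ _ hcd with h0 | ⟨-, hc, hd⟩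
    · rw [h0] at he
      have hne : φ (v, x) ≠ φ (v, y) := by simpa [φ] using h'.ne
      rcases Sym2.eq_iff.1 he with ⟨h1, h2⟩ | ⟨h1, h2⟩
      · exact absurd (h1.symm.trans h2) hne
      · exact absurd (h2.symm.trans h1) hne
    · dsimp only at hc hd
      subst hc hd
      simpa [φ] using he
  · refine hX.isAcyclic.isBridge_of_map Prod.fst (fun c d h => blowUp_fst h) h ?_
    rintro ⟨c, z⟩ ⟨d, t⟩ hcd he
    dsimp only at hx hy he h
    subst hx
    rcases hcd with ⟨h0, -⟩ | ⟨-, hz, ht⟩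
    · dsimp only at h0
      subst h0
      rcases Sym2.eq_iff.1 he with ⟨h1, h2⟩ | ⟨h1, h2⟩
      · exact absurd (h1.symm.trans h2) h.ne
      · exact absurd (h2.symm.trans h1) h.ne
    · dsimp only at hz ht
      rw [he] at hz ht
      subst hz ht hy
      simpa using he

theorem blowUp_smul {G : Type*} [Group G] [MulAction G V] [MulAction G W]
    (hX : ∀ (g : G) a b, X.Adj a b → X.Adj (g • a) (g • b))
    (hY : ∀ (g : G) a b, Y.Adj a b → Y.Adj (g • a) (g • b))
    (hp : ∀ (g : G) a b, X.Adj a b → p s(g • a, g • b) = g • p s(a, b)) (g : G) (a b : V × W)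
    (h : (blowUp X Y p).Adj a b) : (blowUp X Y p).Adj (g • a) (g • b) := by
  rcases h with ⟨h, h'⟩ | ⟨h, ha, hb⟩
  · exact .inl ⟨congrArg (g • ·) h, hY g _ _ h'⟩
  · refine .inr ⟨hX g _ _ h, ?_⟩
    change g • a.2 = p s(g • a.1, g • b.1) ∧ g • b.2 = p s(g • a.1, g • b.1)
    rw [hp g _ _ h, ← ha, hb, ha]
    exact ⟨rfl, rfl⟩

end BlowUp

end SimpleGraph

/-- If the stabilizer of every element of `α` satisfying `P` fixes an element of `β`, then there
is a map `α → β` equivariant at the elements satisfying `P`. -/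
theorem MulAction.exists_equivariant_map {G α β : Type*} [Group G] [MulAction G α] [MulAction G β]
    [Nonempty β] (P : α → Prop) (hP : ∀ (g : G) a, P a → P (g • a))
    (h : ∀ a, P a → ∃ b : β, ∀ g : G, g • a = a → g • b = b) :
    ∃ p : α → β, ∀ (g : G) a, P a → p (g • a) = g • p a := by
  classical
  let rep : α → α := fun a =>
    (Quotient.out (Quotient.mk (MulAction.orbitRel G α) a) : α)
  have hrep : ∀ a, ∃ g : G, g • rep a = a := fun a =>
    (MulAction.orbitRel G α).symm (Quotient.mk_out (s := MulAction.orbitRel G α) a)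
  have hrep' : ∀ (g : G) a, rep (g • a) = rep a := fun g a =>
    congrArg Quotient.out (Quotient.sound (s := MulAction.orbitRel G α) ⟨g, rfl⟩)
  choose t ht using hrep
  have hq : ∀ a, ∃ b : β, P a → ∀ g : G, g • a = a → g • b = b := fun a => by
    by_cases ha : P a
    · exact (h a ha).imp fun b hb _ => hb
    · exact ⟨Classical.arbitrary β, fun h => absurd h ha⟩
  choose q hq using hq
  refine ⟨fun a => t a • q (rep a), fun g a ha => ?_⟩
  have hPr : P (rep a) := by
    have := hP (t a)⁻¹ a ha
    rwa [inv_smul_eq_iff.2 (ht a).symm] at this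
  have hfix : (t a)⁻¹ • g⁻¹ • t (g • a) • rep a = rep a := by
    have h1 := ht (g • a)
    rw [hrep'] at h1
    rw [h1, inv_smul_smul, inv_smul_eq_iff, ht a]
  have := hq (rep a) hPr ((t a)⁻¹ * (g⁻¹ * t (g • a))) (by simpa only [mul_smul] using hfix)
  rw [mul_smul, mul_smul, inv_smul_eq_iff, inv_smul_eq_iff] at this
  simp only [hrep', this]

namespace GTree

variable {G : Type u} [Group G]

instance (T : GTree G) : MulAction G T.V where
  smul := T.act
  one_smul := T.act_one
  mul_smul := T.act_mul

theorem isTree (T : GTree G) : T.graph.IsTree := ⟨T.connected, T.acyclic⟩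

/-- Equivariant attaching points in `T₂` for the edges of `T₁`. -/
theorem exists_attaching_map {T₁ T₂ : GTree G}
    (hell : ∀ a b : T₁.V, T₁.graph.Adj a b → T₂.EllipticSubgroup (T₁.edgeStab a b)) :
    ∃ p : Sym2 T₁.V → T₂.V, ∀ (g : G) a b, T₁.graph.Adj a b →
      p s(g • a, g • b) = g • p s(a, b) := by
  have := T₂.nonempty
  let _ : MulAction G (Sym2 T₁.V) :=
    { smul := fun g => Sym2.map (g • ·)
      one_smul := fun e => by
        induction e with | _ a b => exact congrArg₂ (fun x y => s(x, y)) (one_smul G a) (one_smul G b)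
      mul_smul := fun g h e => by
        induction e with
        | _ a b => exact congrArg₂ (fun x y => s(x, y)) (mul_smul g h a) (mul_smul g h b) }
  obtain ⟨p, hp⟩ := MulAction.exists_equivariant_map (G := G) (β := T₂.V)
    (fun e : Sym2 T₁.V => e ∈ T₁.graph.edgeSet)
    (fun g e => by
      induction e with | _ a b => exact T₁.act_adj g a b)
    (fun e => by
      induction e with
      | _ a b =>
        intro hab
        obtain ⟨w, hw⟩ := hell a b hab
        refine ⟨w, fun g hg => ?_⟩
        have hg' : s(T₁.act g a, T₁.act g b) = s(a, b) := hg
        rcases Sym2.eq_iff.1 hg' with h | h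
        · exact hw g h
        · exact absurd h (T₁.noInversion g a b hab))
  exact ⟨p, fun g a b hab => hp g s(a, b) hab⟩

/-- An equivariant map to a `G`-tree sending edges to edges or vertices is surjective. -/
theorem surjective_of_equivariant {V : Type*} [MulAction G V] {X : SimpleGraph V}
    (hX : X.Connected) (T : GTree G) (φ : V → T.V) (hφ : ∀ (g : G) v, φ (g • v) = g • φ v)
    (hadj : ∀ a b, X.Adj a b → φ a = φ b ∨ T.graph.Adj (φ a) (φ b)) : Function.Surjective φ := by
  obtain ⟨x⟩ := hX.nonempty
  rw [← Set.range_eq_univ]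
  refine T.minimal _ ⟨φ x, x, rfl⟩ ?_ ?_
  · rintro g _ ⟨v, rfl⟩
    exact ⟨g • v, hφ g v⟩
  · have : Nonempty (Set.range φ) := ⟨⟨φ x, x, rfl⟩⟩
    refine ⟨?_⟩
    rintro ⟨_, a, rfl⟩ ⟨_, b, rfl⟩
    refine (hX.preconnected a b).map_of_adj (fun c => (⟨φ c, c, rfl⟩ : Set.range φ)) ?_
    intro c d h
    rcases hadj c d h with h' | h'
    · simp only [h']; rfl
    · exact SimpleGraph.Adj.reachable (by rw [SimpleGraph.induce_adj]; exact h')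

/-- The `G`-tree spanned by a minimal invariant connected set of vertices. -/
def ofMinimal {V : Type u} [MulAction G V] (X : SimpleGraph V) (hX : X.IsAcyclic)
    (hadj : ∀ (g : G) a b, X.Adj a b → X.Adj (g • a) (g • b))
    (hinv : ∀ (g : G) a b, X.Adj a b → ¬(g • a = b ∧ g • b = a)) (Y : Set V) (hne : Y.Nonempty)
    (hY : ∀ (g : G), ∀ y ∈ Y, g • y ∈ Y) (hpre : (X.induce Y).Preconnected)
    (hmin : ∀ S ⊆ Y, S.Nonempty → (∀ (g : G), ∀ y ∈ S, g • y ∈ S) → (X.induce S).Preconnected →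
      S = Y) : GTree G where
  V := Y
  graph := X.induce Y
  nonempty := hne.to_subtype
  connected := have := hne.to_subtype; ⟨hpre⟩
  acyclic := hX.induce Y
  act g y := ⟨g • y.1, hY g _ y.2⟩
  act_one y := Subtype.ext (one_smul G y.1)
  act_mul g h y := Subtype.ext (mul_smul g h y.1)
  act_adj g a b h := hadj g a.1 b.1 h
  noInversion g a b h := fun h' => hinv g a.1 b.1 h
    ⟨congrArg Subtype.val h'.1, congrArg Subtype.val h'.2⟩
  minimal S hS hSinv hSconn := by
    have himg : Subtype.val '' S = Y := by
      refine hmin _ (by simp) (hS.image _) ?_ ?_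
      · rintro g _ ⟨y, hy, rfl⟩
        exact ⟨_, hSinv g y hy, rfl⟩
      · rintro ⟨_, a, ha, rfl⟩ ⟨_, b, hb, rfl⟩
        exact (hSconn.preconnected ⟨a, ha⟩ ⟨b, hb⟩).map_of_adj
          (fun c => (⟨c.1.1, c.1, c.2, rfl⟩ : (Subtype.val '' S : Set V)))
          fun c d h => SimpleGraph.Adj.reachable (by rwa [SimpleGraph.induce_adj] at h ⊢)
    refine Set.eq_univ_of_forall fun y => ?_
    obtain ⟨z, hz, hzy⟩ : y.1 ∈ Subtype.val '' S := himg.symm ▸ y.2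
    exact Subtype.ext hzy ▸ hz

end GTree

/-- the refinement lemma. -/
theorem refinement_lemma {G : Type u} [Group G] (hfg : Group.FG G)
    (𝒜 : Set (Subgroup G)) (h𝒜 : ClosedFamily 𝒜)
    (T₁ T₂ : GTree G) (h₁ : T₁.IsATree 𝒜) (h₂ : T₂.IsATree 𝒜)
    (hell : ∀ a b : T₁.V, T₁.graph.Adj a b → T₂.EllipticSubgroup (T₁.edgeStab a b)) :
    ∃ (T : GTree G) (f : T.V → T₁.V), T.IsATree 𝒜 ∧ GTree.IsCollapseMap T T₁ f ∧
      T.Dominates T₂ ∧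
      (∀ a b : T.V, T.graph.Adj a b →
        (∃ c d : T₁.V, T₁.graph.Adj c d ∧ T.edgeStab a b ≤ T₁.edgeStab c d) ∨
        (∃ c d : T₂.V, T₂.graph.Adj c d ∧ T.edgeStab a b ≤ T₂.edgeStab c d)) ∧
      (∀ c d : T₂.V, T₂.graph.Adj c d →
        ∃ a b : T.V, T.graph.Adj a b ∧ T.edgeStab a b ≤ T₂.edgeStab c d) ∧
      ∀ H : Subgroup G, T.EllipticSubgroup H ↔
        T₁.EllipticSubgroup H ∧ T₂.EllipticSubgroup H := by
  obtain ⟨p, hp⟩ := GTree.exists_attaching_map hell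
  let X := SimpleGraph.blowUp T₁.graph T₂.graph p
  have hadj : ∀ (g : G) a b, X.Adj a b → X.Adj (g • a) (g • b) :=
    SimpleGraph.blowUp_smul T₁.act_adj T₂.act_adj hp
  have hconn : X.Connected := SimpleGraph.connected_blowUp T₁.connected T₂.connected
  have hacyc : X.IsAcyclic := SimpleGraph.isAcyclic_blowUp T₁.isTree T₂.acyclic
  have hinv : ∀ (g : G) a b, X.Adj a b → ¬(g • a = b ∧ g • b = a) := by
    rintro g a b (⟨-, h⟩ | ⟨h, -⟩) ⟨hab, hba⟩
    · exact T₂.noInversion g _ _ h ⟨congrArg Prod.snd hab, congrArg Prod.snd hba⟩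
    · exact T₁.noInversion g _ _ h ⟨congrArg Prod.fst hab, congrArg Prod.fst hba⟩
  obtain ⟨Y, hne, hY, hpre, hmin⟩ := hconn.exists_minimal_invariant hadj
  let T := GTree.ofMinimal X hacyc hadj hinv Y hne hY hpre hmin
  have hstab₁ : ∀ (y : T.V) (g : G), T.act g y = y → T₁.act g y.1.1 = y.1.1 := fun y g h =>
    congrArg (fun z : Y => z.1.1) h
  have hstab₂ : ∀ (y : T.V) (g : G), T.act g y = y → T₂.act g y.1.2 = y.1.2 := fun y g h =>
    congrArg (fun z : Y => z.1.2) h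
  have hedge : ∀ a b : T.V, T.graph.Adj a b →
      (∃ c d : T₁.V, T₁.graph.Adj c d ∧ T.edgeStab a b ≤ T₁.edgeStab c d) ∨
      (∃ c d : T₂.V, T₂.graph.Adj c d ∧ T.edgeStab a b ≤ T₂.edgeStab c d) := by
    rintro a b (⟨-, h⟩ | ⟨h, -⟩)
    · exact .inr ⟨_, _, h, fun g hg => ⟨hstab₂ a g hg.1, hstab₂ b g hg.2⟩⟩
    · exact .inl ⟨_, _, h, fun g hg => ⟨hstab₁ a g hg.1, hstab₁ b g hg.2⟩⟩
  have hadj₁ : ∀ a b : T.V, T.graph.Adj a b → a.1.1 = b.1.1 ∨ T₁.graph.Adj a.1.1 b.1.1 :=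
    fun _ _ h => SimpleGraph.blowUp_fst h
  have hadj₂ : ∀ a b : T.V, T.graph.Adj a b → a.1.2 = b.1.2 ∨ T₂.graph.Adj a.1.2 b.1.2 :=
    fun _ _ h => SimpleGraph.blowUp_snd h
  have hsurj₁ : Function.Surjective fun y : T.V => y.1.1 :=
    T₁.surjective_of_equivariant T.connected (fun y : T.V => y.1.1) (fun _ _ => rfl) hadj₁
  have hsurj₂ : Function.Surjective fun y : T.V => y.1.2 :=
    T₂.surjective_of_equivariant T.connected (fun y : T.V => y.1.2) (fun _ _ => rfl) hadj₂
  have hell₁ : T.Dominates T₁ := by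
    rintro H ⟨w, hw⟩
    exact ⟨w.1.1, fun h hh => hstab₁ w h (hw h hh)⟩
  have hell₂ : T.Dominates T₂ := by
    rintro H ⟨w, hw⟩
    exact ⟨w.1.2, fun h hh => hstab₂ w h (hw h hh)⟩
  refine ⟨T, fun y => y.1.1, ?_, ⟨fun _ _ => rfl, hsurj₁, hadj₁, ?_⟩, hell₂, hedge, ?_, fun H =>
    ⟨fun h => ⟨hell₁ H h, hell₂ H h⟩, ?_⟩⟩
  · intro a b h
    rcases hedge a b h with ⟨c, d, hcd, hle⟩ | ⟨c, d, hcd, hle⟩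
    · exact h𝒜.2 _ (h₁ c d hcd) _ hle
    · exact h𝒜.2 _ (h₂ c d hcd) _ hle
  · intro w
    obtain ⟨y, hy⟩ := hsurj₁ w
    have : Nonempty ((fun y : T.V => y.1.1) ⁻¹' {w}) := ⟨⟨y, hy⟩⟩
    refine ⟨?_⟩
    rintro ⟨a, ha⟩ ⟨b, hb⟩
    refine (hacyc.preconnected_induce_inter hpre
      (SimpleGraph.preconnected_blowUp_fiber T₂.connected.preconnected w)
      ⟨a.1, a.2, ha⟩ ⟨b.1, b.2, hb⟩).map_of_adj
      (fun c => (⟨⟨c.1, c.2.1⟩, c.2.2⟩ : (fun y : T.V => y.1.1) ⁻¹' {w}))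
      fun c d h => SimpleGraph.Adj.reachable ?_
    change X.Adj c.1 d.1
    exact h
  · intro c d hcd
    by_contra! hno
    obtain ⟨a, ha⟩ := hsurj₂ c
    obtain ⟨b, hb⟩ := hsurj₂ d
    refine SimpleGraph.isBridge_iff.1
      (SimpleGraph.isAcyclic_iff_forall_adj_isBridge.1 T₂.acyclic hcd) ?_
    rw [← ha, ← hb]
    refine (T.connected.preconnected a b).map_of_adj (fun y : T.V => y.1.2) fun x y hxy => ?_
    rcases hadj₂ x y hxy with h | h
    · simp only [h]; rfl
    · refine SimpleGraph.Adj.reachable ?_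
      rw [SimpleGraph.deleteEdges_adj, Set.mem_singleton_iff]
      refine ⟨h, fun he => hno x y hxy fun g hg => ?_⟩
      have h1 := hstab₂ x g hg.1
      have h2 := hstab₂ y g hg.2
      dsimp only at ha hb he
      rw [ha, hb] at he
      rcases Sym2.eq_iff.1 he with ⟨hc, hd⟩ | ⟨hd, hc⟩
      · exact ⟨hc ▸ h1, hd ▸ h2⟩
      · exact ⟨hc ▸ h2, hd ▸ h1⟩
  · rintro ⟨⟨v, hv⟩, ⟨x, hx⟩⟩
    obtain ⟨y, hy, hfix⟩ := SimpleGraph.IsTree.exists_fixed_mem ⟨hconn, hacyc⟩ hadj hne hY hpre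
      (H := H) (z := (v, x)) fun h hh => Prod.ext (hv h hh) (hx h hh)
    exact ⟨⟨y, hy⟩, fun h hh => Subtype.ext (hfix h hh)⟩
end
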